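/- Let k ≥ 3 be an integer and r := (3^k + 1)/2 (so 3^{k+1} = 6r − 3). Set R := B_{3^{k+1}}(3r+3) ∖ {(3r+2, 3r−5), (3r+2, 1^{3r−5}), (3r−1, 3r−2)}° ⊆ P(3^{k+1}). Then D(3, 3^{k+1}, R) = D(3, 3^{k+1}, R ∪ {(3r−1, 3r−2)}°). -/

import Mathlib

open scoped Classical

namespace SylowBranching

/-- The cells of the Young diagram of `f` (rows indexed by the first coordinate,
starting from `0`; `f i` is the length of row `i`). -/
def cellsOf (f : ℕ → ℕ) : Set (ℕ × ℕ) := {p | p.2 < f p.1}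

/-- `f : ℕ → ℕ` is a partition if it is weakly decreasing with finitely many
nonzero parts.  Its parts are `f 0 ≥ f 1 ≥ ⋯`, and its largest part is `f 0`. -/
def IsPartition (f : ℕ → ℕ) : Prop :=
  Antitone f ∧ ∃ N, ∀ i, N ≤ i → f i = 0

/-- The size `|f|` of a partition: the number of cells of its Young diagram. -/
noncomputable def psize (f : ℕ → ℕ) : ℕ := (cellsOf f).ncard

/-- `P(n)`: the set of partitions of `n`. -/
def Pset (n : ℕ) : Set (ℕ → ℕ) := {f | IsPartition f ∧ psize f = n}

/-- The conjugate (transpose) partition `f'`. -/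
noncomputable def conj (f : ℕ → ℕ) : ℕ → ℕ := fun j => Set.ncard {i | j < f i}

/-- `A° = A ∪ A'`: the closure of a set of partitions under conjugation. -/
noncomputable def conjClosure (A : Set (ℕ → ℕ)) : Set (ℕ → ℕ) := A ∪ conj '' A

/-- `B_n(t)`: partitions of `n` with largest part at most `t` and at most `t` parts. -/
noncomputable def Bset (n t : ℕ) : Set (ℕ → ℕ) :=
  {f ∈ Pset n | f 0 ≤ t ∧ conj f 0 ≤ t}

/-- The cells of the skew shape `l / m`. -/
def skewCells (l m : ℕ → ℕ) : Set (ℕ × ℕ) :=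
  {p | m p.1 ≤ p.2 ∧ p.2 < l p.1}

/-- `d` is read before (or at the same time as) `c` in the reading order of a
filling: right-to-left along rows, rows from top to bottom. -/
def readBefore (d c : ℕ × ℕ) : Prop :=
  d.1 < c.1 ∨ (d.1 = c.1 ∧ c.2 ≤ d.2)

/-- A Littlewood–Richardson filling of the cell set `γ` of weight `ν`:
all entries are positive; for every `j ≥ 1` there are exactly `ν (j-1)` entries
equal to `j` (i.e. the number of `j`s is the `j`-th part of `ν`); entries weakly
increase along rows and strictly increase down columns; and every initial
segment of the reading word (right-to-left along rows, top to bottom) contains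
at least as many entries equal to `j` as entries equal to `j+1`, for all `j ≥ 1`. -/
structure IsLRFilling (γ : Set (ℕ × ℕ)) (ν : ℕ → ℕ) (T : ℕ × ℕ → ℕ) : Prop where
  pos : ∀ c ∈ γ, 1 ≤ T c
  weight : ∀ j : ℕ, 1 ≤ j → Set.ncard {c ∈ γ | T c = j} = ν (j - 1)
  row_weak : ∀ i j j', (i, j) ∈ γ → (i, j') ∈ γ → j ≤ j' → T (i, j) ≤ T (i, j')
  col_strict : ∀ i i' j, (i, j) ∈ γ → (i', j) ∈ γ → i < i' → T (i, j) < T (i', j)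
  lattice : ∀ c ∈ γ, ∀ j : ℕ, 1 ≤ j →
    Set.ncard {d ∈ γ | T d = j + 1 ∧ readBefore d c} ≤
      Set.ncard {d ∈ γ | T d = j ∧ readBefore d c}

/-- `LR(γ)`: the set of all weights of LR fillings of `γ`. -/
def LRset (γ : Set (ℕ × ℕ)) : Set (ℕ → ℕ) := {ν | ∃ T, IsLRFilling γ ν T}

/-- The Littlewood–Richardson coefficient `c^l_{m ν}`: the number of LR fillings
of the skew shape `l / m` of weight `ν` (zero unless `m ⊆ l`); fillings are
normalised to vanish off the skew shape so that they can be counted. -/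
noncomputable def LRcoeff (l m ν : ℕ → ℕ) : ℕ :=
  Set.ncard {T : ℕ × ℕ → ℕ |
    (∀ i, m i ≤ l i) ∧ (∀ c, c ∉ skewCells l m → T c = 0) ∧
      IsLRFilling (skewCells l m) ν T}

/-- The `⋆` operation on sets of partitions:
`A ⋆ B = {λ : c^λ_{μν} > 0 for some μ ∈ A, ν ∈ B}`. -/
def starOp (A B : Set (ℕ → ℕ)) : Set (ℕ → ℕ) :=
  {l | IsPartition l ∧ ∃ μ ∈ A, ∃ ν ∈ B, 0 < LRcoeff l μ ν}

/-- The partition with the given (weakly decreasing) list of parts. -/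
def ofList (L : List ℕ) : ℕ → ℕ := fun i => L.getD i 0

/-- The hook partition `(a, 1^b)`. -/
def hookP (a b : ℕ) : ℕ → ℕ := ofList (a :: List.replicate b 1)

/-- The partition `(a, μ)` obtained by prepending a first part `a` to `μ`. -/
def consPart (a : ℕ) (μ : ℕ → ℕ) : ℕ → ℕ := fun i => if i = 0 then a else μ (i - 1)

/-- `γ` coincides, up to planar translation, with the Young diagram of `ν`. -/
def TranslateOf (γ : Set (ℕ × ℕ)) (ν : ℕ → ℕ) : Prop :=
  ∃ a b : ℕ, γ = (fun p : ℕ × ℕ => (p.1 + a, p.2 + b)) '' cellsOf ν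

/-- `γ` coincides, up to planar translation, with the 180°-rotation of the
Young diagram of `ν`. -/
def RotationOf (γ : Set (ℕ × ℕ)) (ν : ℕ → ℕ) : Prop :=
  ∃ a b : ℕ, (∀ p ∈ cellsOf ν, p.1 ≤ a ∧ p.2 ≤ b) ∧
    γ = (fun p : ℕ × ℕ => (a - p.1, b - p.2)) '' cellsOf ν

/-- Iterated Littlewood–Richardson coefficients `c^l_{μ^1, …, μ^r}`:
`c^l_{μ} = δ_{l μ}`, and the coefficient for a longer list is obtained by
summing, over partitions `g` of the total size of the remaining factors, the
product of the iterated coefficient of `g` with `c^l_{g μ}`. -/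
noncomputable def iterLR : List (ℕ → ℕ) → (ℕ → ℕ) → ℕ
  | [], l => if l = (fun _ => 0 : ℕ → ℕ) then 1 else 0
  | [μ], l => if l = μ then 1 else 0
  | μ :: μs, l =>
      ∑' g : {g : ℕ → ℕ // IsPartition g ∧ psize g = (μs.map psize).sum},
        iterLR μs g.1 * LRcoeff l g.1 μ

/-- `D(q, m, B)`: partitions `λ` of `qm` with `c^λ_{μ_1, …, μ_q} > 0` for some
`μ_1, …, μ_q ∈ B` that are not all equal. -/
noncomputable def Dset (q m : ℕ) (B : Set (ℕ → ℕ)) : Set (ℕ → ℕ) :=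
  {l ∈ Pset (q * m) | ∃ μ : Fin q → (ℕ → ℕ),
    (∀ i, μ i ∈ B) ∧ (∃ i j, μ i ≠ μ j) ∧ 0 < iterLR (List.ofFn μ) l}

/-- Iterated `⋆` of a list of sets of partitions. -/
def starAll : List (Set (ℕ → ℕ)) → Set (ℕ → ℕ)
  | [] => Pset 0
  | [A] => A
  | A :: B :: rest => starOp A (starAll (B :: rest))

/-- `Ω(φ(1,0,…,0))` for the Sylow 3-subgroup of `S_{3^k}` (`k ≥ 4`):
`B_{3^k}(2a) ∖ {(2a, a−1, 1), (2a, 2, 1^{a−2}), (2a−1, a+1), (2a−1, 1^{a+1})}°`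
where `a = 3^{k−1}`. -/
noncomputable def Cset (k : ℕ) : Set (ℕ → ℕ) :=
  Bset (3 ^ k) (2 * 3 ^ (k - 1)) \
    conjClosure
      {ofList [2 * 3 ^ (k - 1), 3 ^ (k - 1) - 1, 1],
       ofList (2 * 3 ^ (k - 1) :: 2 :: List.replicate (3 ^ (k - 1) - 2) 1),
       ofList [2 * 3 ^ (k - 1) - 1, 3 ^ (k - 1) + 1],
       hookP (2 * 3 ^ (k - 1) - 1) (3 ^ (k - 1) + 1)}

/-- Functions to `ℕ` that vanish off a finite set and are bounded form a finite set. -/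
theorem finite_bounded_support {ι : Type*} {S : Set ι} (hS : S.Finite) (K : ℕ) :
    {f : ι → ℕ | (∀ c, c ∉ S → f c = 0) ∧ ∀ c ∈ S, f c ≤ K}.Finite := by
  have : Finite S := hS
  refine Set.Finite.of_finite_image (f := fun f : ι → ℕ => fun s : S => f s) ?_ ?_
  · refine (Set.Finite.pi' (t := fun _ : S => Set.Iic K) fun _ => Set.finite_Iic K).subset ?_
    rintro _ ⟨f, hf, rfl⟩ s
    exact hf.2 s s.2
  · intro f hf g hg h
    funext c
    by_cases hc : c ∈ S
    · exact congrFun h ⟨c, hc⟩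
    · rw [hf.1 c hc, hg.1 c hc]

/-- The number of cells between two row-length functions in the first `I` rows. -/
theorem ncard_between (lo hi : ℕ → ℕ) (I : ℕ) :
    Set.ncard {p : ℕ × ℕ | p.1 < I ∧ lo p.1 ≤ p.2 ∧ p.2 < hi p.1} =
      ∑ i ∈ Finset.range I, (hi i - lo i) := by
  have : {p : ℕ × ℕ | p.1 < I ∧ lo p.1 ≤ p.2 ∧ p.2 < hi p.1} =
      (((Finset.range I).sigma fun i => Finset.Ico (lo i) (hi i)).map
        (Equiv.sigmaEquivProd ℕ ℕ).toEmbedding : Finset (ℕ × ℕ)) := by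
    ext ⟨a, b⟩
    simp
  rw [this, Set.ncard_coe_finset]
  simp

theorem finite_between (lo hi : ℕ → ℕ) (I : ℕ) :
    {p : ℕ × ℕ | p.1 < I ∧ lo p.1 ≤ p.2 ∧ p.2 < hi p.1}.Finite := by
  refine ((Set.finite_Iio I).prod (Set.finite_Iio ((Finset.range I).sup hi))).subset ?_
  rintro ⟨a, b⟩ ⟨h1, -, h3⟩
  exact ⟨h1, lt_of_lt_of_le h3 (Finset.le_sup (f := hi) (Finset.mem_range.2 h1))⟩

/-- A chain of shapes from `m` to `l`, the `j`-th step being a horizontal strip of size `ν j`,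
that satisfies the lattice condition; `B j` is the shape covered by `m` and the entries at
most `j` of a Littlewood–Richardson filling of `l / m`. -/
structure IsLRChain (l m ν : ℕ → ℕ) (B : ℕ → ℕ → ℕ) : Prop where
  zero : B 0 = m
  le_top : ∀ j i, B j i ≤ l i
  mono : ∀ j i, B j i ≤ B (j + 1) i
  strip : ∀ j i, B (j + 1) (i + 1) ≤ B j i
  top : ∃ J, ∀ j, J ≤ j → B j = l
  weight : ∃ N, (∀ i, N ≤ i → l i = 0) ∧ ∀ j, ∀ I, N ≤ I →
    ∑ i ∈ Finset.range I, B (j + 1) i = ∑ i ∈ Finset.range I, B j i + ν j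
  lattice : ∀ j i, ∑ a ∈ Finset.range (i + 1), B (j + 2) a + ∑ a ∈ Finset.range i, B j a ≤
    ∑ a ∈ Finset.range i, B (j + 1) a + ∑ a ∈ Finset.range (i + 1), B (j + 1) a

/-- A Littlewood–Richardson chain certifies that the coefficient is positive. -/
theorem IsLRChain.pos {l m ν : ℕ → ℕ} {B : ℕ → ℕ → ℕ} (h : IsLRChain l m ν B) :
    0 < LRcoeff l m ν := by
  obtain ⟨N, hN, hw⟩ := h.weight
  obtain ⟨J, hJ⟩ := h.top
  have hmono : ∀ i, Monotone fun j => B j i := fun i => monotone_nat_of_le_succ fun j => h.mono j i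
  have hanti : ∀ j, Antitone (B j) := fun j =>
    antitone_nat_of_succ_le fun i => (h.mono j (i + 1)).trans (h.strip j i)
  have hsmall : ∀ p ∈ skewCells l m, p.1 < N := by
    rintro ⟨a, b⟩ ⟨-, h2⟩
    by_contra hc
    simp only [not_lt] at hc
    simp [hN a hc] at h2
  have hfin : (skewCells l m).Finite := by
    refine (finite_between m l N).subset fun p hp => ⟨hsmall p hp, hp.1, hp.2⟩
  let F : ℕ × ℕ → ℕ := fun p => sInf {j | p.2 < B j p.1}
  let T : ℕ × ℕ → ℕ := fun p => if p ∈ skewCells l m then F p else 0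
  have hT : ∀ p j, (p ∈ skewCells l m ∧ T p = j + 1) ↔ (B j p.1 ≤ p.2 ∧ p.2 < B (j + 1) p.1) := by
    rintro p j
    constructor
    · rintro ⟨hp, hj⟩
      simp only [T, hp, if_true] at hj
      have hne : {j | p.2 < B j p.1}.Nonempty := ⟨J, by
        have := hp.2; rw [← hJ J le_rfl] at this; exact this⟩
      have h1 : p.2 < B (F p) p.1 := Nat.sInf_mem hne
      have h2 : ¬ p.2 < B j p.1 := fun hc => by
        have : F p ≤ j := Nat.sInf_le hc
        omega
      rw [hj] at h1
      exact ⟨not_lt.1 h2, h1⟩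
    · rintro ⟨h1, h2⟩
      have hp : p ∈ skewCells l m := by
        refine ⟨?_, h2.trans_le (h.le_top _ _)⟩
        rw [← h.zero]
        exact (hmono p.1 (Nat.zero_le j)).trans h1
      refine ⟨hp, ?_⟩
      simp only [T, hp, if_true]
      have hle : F p ≤ j + 1 := Nat.sInf_le h2
      have hmem : p.2 < B (F p) p.1 := Nat.sInf_mem (s := {j | p.2 < B j p.1}) ⟨j + 1, h2⟩
      by_contra hne
      have : F p ≤ j := by omega
      have := hmono p.1 this
      simp only at this
      omega
  have hTpos : ∀ p ∈ skewCells l m, 1 ≤ T p := by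
    intro p hp
    by_contra hc
    have h0 : F p = 0 := by
      have : T p = 0 := by omega
      simpa only [T, hp, if_true] using this
    have hne : {j | p.2 < B j p.1}.Nonempty := ⟨J, by
      have := hp.2; rw [← hJ J le_rfl] at this; exact this⟩
    have h1 : p.2 < B (F p) p.1 := Nat.sInf_mem hne
    rw [h0, h.zero] at h1
    exact absurd hp.1 (not_le.2 h1)
  have hset : ∀ j, {c ∈ skewCells l m | T c = j + 1} =
      {p : ℕ × ℕ | p.1 < N ∧ B j p.1 ≤ p.2 ∧ p.2 < B (j + 1) p.1} := by
    intro j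
    ext p
    constructor
    · intro hp
      exact ⟨hsmall p hp.1, (hT p j).1 hp⟩
    · intro hp
      exact (hT p j).2 hp.2
  have hsum : ∀ j I, ∑ i ∈ Finset.range I, (B (j + 1) i - B j i) + ∑ i ∈ Finset.range I, B j i =
      ∑ i ∈ Finset.range I, B (j + 1) i := by
    intro j I
    rw [← Finset.sum_add_distrib]
    exact Finset.sum_congr rfl fun i _ => Nat.sub_add_cancel (h.mono j i)
  have hfill : IsLRFilling (skewCells l m) ν T := by
    refine ⟨hTpos, ?_, ?_, ?_, ?_⟩
    · intro j hj
      obtain ⟨j, rfl⟩ : ∃ a, j = a + 1 := ⟨j - 1, by omega⟩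
      rw [hset, ncard_between]
      have := hsum j N
      have := hw j N le_rfl
      simp only [Nat.add_sub_cancel]
      omega
    · intro i c c' hc hc' hcc
      have h0 := hTpos _ hc
      have h1 := hTpos _ hc'
      obtain ⟨t, ht⟩ : ∃ t, T (i, c') = t + 1 := ⟨T (i, c') - 1, by omega⟩
      obtain ⟨s, hs⟩ : ∃ t, T (i, c) = t + 1 := ⟨T (i, c) - 1, by omega⟩
      have a1 := (hT _ t).1 ⟨hc', ht⟩
      have a2 := (hT _ s).1 ⟨hc, hs⟩
      by_contra hlt
      have : t + 1 ≤ s := by omega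
      have := hmono i this
      simp only at this a1 a2
      omega
    · intro i i' c hc hc' hii
      have h0 := hTpos _ hc
      have h1 := hTpos _ hc'
      obtain ⟨t, ht⟩ : ∃ t, T (i', c) = t + 1 := ⟨T (i', c) - 1, by omega⟩
      obtain ⟨s, hs⟩ : ∃ t, T (i, c) = t + 1 := ⟨T (i, c) - 1, by omega⟩
      have a1 := (hT _ t).1 ⟨hc', ht⟩
      have a2 := (hT _ s).1 ⟨hc, hs⟩
      by_contra hlt
      have : t ≤ s := by omega
      have := hmono i this
      have b2 := h.strip t i
      have b3 := hanti (t + 1) (show i + 1 ≤ i' from hii)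
      simp only at this a1 a2
      omega
    · rintro ⟨i, c⟩ hc j hj
      obtain ⟨j, rfl⟩ : ∃ a, j = a + 1 := ⟨j - 1, by omega⟩
      have hup : {d ∈ skewCells l m | T d = j + 1 + 1 ∧ readBefore d (i, c)} ⊆
          {p : ℕ × ℕ | p.1 < i + 1 ∧ B (j + 1) p.1 ≤ p.2 ∧ p.2 < B (j + 2) p.1} := by
        rintro d ⟨hd, hd1, hd2⟩
        refine ⟨?_, (hT d (j + 1)).1 ⟨hd, hd1⟩⟩
        rcases hd2 with h | h <;> simp at h <;> omega
      have hlow : {p : ℕ × ℕ | p.1 < i ∧ B j p.1 ≤ p.2 ∧ p.2 < B (j + 1) p.1} ⊆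
          {d ∈ skewCells l m | T d = j + 1 ∧ readBefore d (i, c)} := by
        rintro d ⟨hd, hd1⟩
        have := (hT d j).2 hd1
        exact ⟨this.1, this.2, Or.inl hd⟩
      have e1 := Set.ncard_le_ncard hup (finite_between _ _ _)
      have e2 := Set.ncard_le_ncard hlow (hfin.subset fun d hd => hd.1)
      rw [ncard_between] at e1 e2
      have := hsum j i
      have e3 := hsum (j + 1) (i + 1)
      have := h.lattice j i
      rw [show j + 1 + 1 = j + 2 from rfl] at e3
      omega
  have hν : ∀ j, J ≤ j → ν j = 0 := by
    intro j hj
    have := hw j N le_rfl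
    rw [hJ j hj, hJ (j + 1) (by omega)] at this
    omega
  rw [LRcoeff, Set.ncard_pos ?_]
  · refine ⟨T, fun i => ?_, fun c hc => by simp [T, hc], hfill⟩
    rw [← h.zero]
    exact h.le_top 0 i
  · refine (finite_bounded_support hfin J).subset ?_
    rintro S ⟨-, hS0, hS⟩
    refine ⟨hS0, fun c hc => ?_⟩
    by_contra hlt
    have h1 := hS.weight (S c) (by omega)
    rw [hν _ (by omega), Set.ncard_eq_zero (hfin.subset fun d hd => hd.1)] at h1
    exact (h1 ▸ (⟨hc, rfl⟩ : c ∈ {d ∈ skewCells l m | S d = S c}) : c ∈ (∅ : Set (ℕ × ℕ)))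

/-! ### Conjugates, sizes and prefixes -/

theorem conj_eq_sum {f : ℕ → ℕ} {C : ℕ} (hf : ∀ c, C ≤ c → f c = 0) (j : ℕ) :
    conj f j = ∑ c ∈ Finset.range C, if j < f c then 1 else 0 := by
  rw [← Finset.card_filter, conj, ← Set.ncard_coe_finset]
  congr 1
  ext c
  simp only [Set.mem_ofPred_eq, Finset.coe_filter, Finset.mem_range]
  constructor
  · intro h
    refine ⟨?_, h⟩
    by_contra hc
    rw [hf c (not_lt.1 hc)] at h
    omega
  · exact fun h => h.2

theorem sum_indicator_lt (a I : ℕ) :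
    (∑ i ∈ Finset.range I, if i < a then 1 else 0) = min a I := by
  induction I with
  | zero => simp
  | succ I ih =>
    rw [Finset.sum_range_succ, ih]
    split_ifs <;> omega

theorem sum_conj {f : ℕ → ℕ} {C : ℕ} (hf : ∀ c, C ≤ c → f c = 0) (I : ℕ) :
    ∑ i ∈ Finset.range I, conj f i = ∑ c ∈ Finset.range C, min (f c) I := by
  simp_rw [conj_eq_sum hf]
  rw [Finset.sum_comm]
  exact Finset.sum_congr rfl fun c _ => sum_indicator_lt (f c) I

theorem conj_le_conj {f g : ℕ → ℕ} {C : ℕ} (hg : ∀ c, C ≤ c → g c = 0) {i j : ℕ}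
    (h : ∀ c, i < f c → j < g c) : conj f i ≤ conj g j := by
  refine Set.ncard_le_ncard (fun c hc => h c hc) ((Set.finite_Iio C).subset fun c hc => ?_)
  by_contra hlt
  have h1 : j < g c := hc
  rw [hg c (not_lt.1 hlt)] at h1
  omega

theorem conj_eq_zero {f : ℕ → ℕ} {i : ℕ} (h : ∀ c, f c ≤ i) : conj f i = 0 := by
  rw [conj]
  have : {c | i < f c} = ∅ := by
    ext c
    simpa using h c
  rw [this, Set.ncard_empty]

theorem le_sum_of_support {f : ℕ → ℕ} {C : ℕ} (hf : ∀ c, C ≤ c → f c = 0) (c : ℕ) :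
    f c ≤ ∑ c ∈ Finset.range C, f c := by
  by_cases hc : c < C
  · exact Finset.single_le_sum (f := f) (fun _ _ => Nat.zero_le _) (Finset.mem_range.2 hc)
  · rw [hf c (not_lt.1 hc)]
    exact Nat.zero_le _

theorem isPartition_conj {f : ℕ → ℕ} {C : ℕ} (hf : ∀ c, C ≤ c → f c = 0) :
    IsPartition (conj f) :=
  ⟨fun _ _ hij => conj_le_conj hf fun _ hc => lt_of_le_of_lt hij hc,
    ∑ c ∈ Finset.range C, f c, fun _ hi => conj_eq_zero fun c => (le_sum_of_support hf c).trans hi⟩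

theorem psize_eq_sum {f : ℕ → ℕ} {N : ℕ} (hf : ∀ i, N ≤ i → f i = 0) :
    psize f = ∑ i ∈ Finset.range N, f i := by
  have h := ncard_between (fun _ => 0) f N
  simp only [Nat.sub_zero] at h
  rw [← h, psize, cellsOf]
  congr 1
  ext p
  simp only [Set.mem_ofPred_eq, Nat.zero_le, true_and]
  constructor
  · intro hp
    refine ⟨?_, hp⟩
    by_contra hc
    rw [hf _ (not_lt.1 hc)] at hp
    omega
  · exact fun hp => hp.2

theorem psize_conj {f : ℕ → ℕ} {C : ℕ} (hf : ∀ c, C ≤ c → f c = 0) :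
    psize (conj f) = ∑ c ∈ Finset.range C, f c := by
  rw [psize_eq_sum (N := ∑ c ∈ Finset.range C, f c)
    fun i hi => conj_eq_zero fun c => (le_sum_of_support hf c).trans hi, sum_conj hf]
  exact Finset.sum_congr rfl fun c _ => min_eq_left (le_sum_of_support hf c)

theorem ncard_Iio (a : ℕ) : (Set.Iio a).ncard = a := by
  rw [Set.ncard_eq_toFinset_card']
  simp

theorem lt_conj_iff {f : ℕ → ℕ} (hf : IsPartition f) (c j : ℕ) : c < conj f j ↔ j < f c := by
  obtain ⟨ha, N, hN⟩ := hf
  have hfin : {i | j < f i}.Finite := (Set.finite_Iio N).subset fun i hi => by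
    by_contra hc
    have h1 : j < f i := hi
    rw [hN i (not_lt.1 hc)] at h1
    omega
  constructor
  · intro h
    by_contra hj
    have : {i | j < f i} ⊆ Set.Iio c := fun i hi => by
      by_contra hc
      have h1 : j < f i := hi
      have := ha (not_lt.1 hc : c ≤ i)
      omega
    have := Set.ncard_le_ncard this (Set.finite_Iio c)
    rw [ncard_Iio] at this
    exact absurd h (not_lt.2 this)
  · intro h
    have : Set.Iio (c + 1) ⊆ {i | j < f i} := fun i hi =>
      lt_of_lt_of_le h (ha (Nat.lt_succ_iff.1 hi))
    have := Set.ncard_le_ncard this hfin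
    rwa [ncard_Iio] at this

theorem conj_conj {f : ℕ → ℕ} (hf : IsPartition f) : conj (conj f) = f := by
  funext i
  have : {c | i < conj f c} = Set.Iio (f i) := by
    ext c
    exact lt_conj_iff hf i c
  rw [conj, this, ncard_Iio]

theorem IsPartition.conj_support {f : ℕ → ℕ} (hf : IsPartition f) :
    ∀ c, f 0 ≤ c → conj f c = 0 := by
  intro c hc
  by_contra h
  have := (lt_conj_iff hf 0 c).1 (by omega)
  omega

theorem sum_consPart (a : ℕ) (f : ℕ → ℕ) (i : ℕ) :
    ∑ c ∈ Finset.range (i + 1), consPart a f c = a + ∑ c ∈ Finset.range i, f c := by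
  rw [Finset.sum_range_succ', add_comm]
  simp [consPart]

@[simp] theorem consPart_zero (a : ℕ) (f : ℕ → ℕ) : consPart a f 0 = a := rfl

@[simp] theorem consPart_succ (a : ℕ) (f : ℕ → ℕ) (i : ℕ) : consPart a f (i + 1) = f i := rfl

theorem isPartition_consPart {a : ℕ} {f : ℕ → ℕ} (hf : IsPartition f) (h : f 0 ≤ a) :
    IsPartition (consPart a f) := by
  obtain ⟨ha, N, hN⟩ := hf
  refine ⟨antitone_nat_of_succ_le fun i => ?_, N + 1, fun i hi => ?_⟩
  · cases i with
    | zero => exact h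
    | succ i => exact ha (Nat.le_succ i)
  · obtain ⟨i, rfl⟩ : ∃ b, i = b + 1 := ⟨i - 1, by omega⟩
    exact hN i (by omega)

theorem psize_consPart {a : ℕ} {f : ℕ → ℕ} (hf : IsPartition f) :
    psize (consPart a f) = a + psize f := by
  obtain ⟨-, N, hN⟩ := hf
  rw [psize_eq_sum hN, psize_eq_sum (N := N + 1), sum_consPart]
  intro i hi
  obtain ⟨i, rfl⟩ : ∃ b, i = b + 1 := ⟨i - 1, by omega⟩
  exact hN i (by omega)

/-! ### Constructions of chains -/

/-- There is a Littlewood–Richardson chain from `m` to `l` of weight `ν`. -/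
def HasLRChain (l m ν : ℕ → ℕ) : Prop := ∃ B, IsLRChain l m ν B

/-- Splitting every column of a diagram into two pieces. -/
theorem hasLRChain_conj_add {p q : ℕ → ℕ} {C : ℕ} (hp : ∀ c, C ≤ c → p c = 0)
    (hq : ∀ c, C ≤ c → q c = 0) :
    HasLRChain (conj fun c => q c + p c) (conj q) (conj p) := by
  have hs : ∀ j c, C ≤ c → q c + min (p c) j = 0 := fun j c hc => by
    rw [hp c hc, hq c hc]; simp
  have hpq : ∀ c, C ≤ c → q c + p c = 0 := fun c hc => by rw [hp c hc, hq c hc]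
  refine ⟨fun j => conj fun c => q c + min (p c) j, ?_, ?_, ?_, ?_, ?_, ?_, ?_⟩
  · simp
  · exact fun j i => conj_le_conj hpq fun c hc => by omega
  · exact fun j i => conj_le_conj (hs _) fun c hc => by omega
  · exact fun j i => conj_le_conj (hs _) fun c hc => by omega
  · refine ⟨∑ c ∈ Finset.range C, p c, fun j hj => ?_⟩
    congr 1
    funext c
    have := le_sum_of_support hp c
    omega
  · refine ⟨∑ c ∈ Finset.range C, (q c + p c), fun i hi => ?_, fun j I hI => ?_⟩
    · exact conj_eq_zero fun c => (le_sum_of_support hpq c).trans hi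
    · rw [sum_conj (hs _), sum_conj (hs _), conj_eq_sum hp, ← Finset.sum_add_distrib]
      refine Finset.sum_congr rfl fun c _ => ?_
      have := le_sum_of_support hpq c
      split_ifs <;> omega
  · intro j i
    simp only [sum_conj (hs _)]
    rw [← Finset.sum_add_distrib, ← Finset.sum_add_distrib]
    exact Finset.sum_le_sum fun c _ => by omega

/-- Prepending first rows to a chain, moving `u` cells of the weight's first row into the
second row of the inner shape. -/
theorem HasLRChain.consPart {ρ κ δ γ : ℕ → ℕ} {L g k u : ℕ} (h : HasLRChain ρ κ δ)
    (h0 : γ 0 + u = κ 0) (hs : ∀ i, γ (i + 1) = κ (i + 1)) (h1 : κ 1 ≤ γ 0)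
    (hsum : L + u = g + k) (hg : κ 0 ≤ g) (hgL : g ≤ L) (hL : ρ 0 ≤ L) (hδ : δ 0 + u ≤ k) :
    HasLRChain (consPart L ρ) (consPart g γ) (consPart k δ) := by
  obtain ⟨B, hB⟩ := h
  obtain ⟨N, hN, hw⟩ := hB.weight
  obtain ⟨J, hJ⟩ := hB.top
  have hγ : ∀ i, γ i ≤ κ i := fun i => by
    cases i with
    | zero => omega
    | succ i => exact (hs i).le
  have hκ := hB.zero
  have hsumγ : ∀ I, ∑ a ∈ Finset.range (I + 1), γ a + u = ∑ a ∈ Finset.range (I + 1), κ a := by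
    intro I
    rw [Finset.sum_range_succ', Finset.sum_range_succ' κ, Finset.sum_congr rfl fun i _ => hs i]
    omega
  have hpart : ∀ i, ∑ a ∈ Finset.range i, B 1 a ≤ ∑ a ∈ Finset.range i, κ a + δ 0 := by
    intro i
    have h1 := hw 0 (N + i) (by omega)
    have h2 : ∑ a ∈ Finset.Ico i (N + i), B 0 a ≤ ∑ a ∈ Finset.Ico i (N + i), B 1 a :=
      Finset.sum_le_sum fun a _ => hB.mono 0 a
    rw [← Finset.sum_range_add_sum_Ico _ (show i ≤ N + i by omega),
      ← Finset.sum_range_add_sum_Ico _ (show i ≤ N + i by omega), zero_add] at h1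
    rw [← hκ]
    omega
  refine ⟨fun j => if j = 0 then SylowBranching.consPart g γ else
    SylowBranching.consPart L (B (j - 1)), ?_, ?_, ?_, ?_, ?_, ?_, ?_⟩
  · simp
  · rintro (_ | j) (_ | i)
    · simpa using hgL
    · simpa using ((hγ i).trans (by rw [← hκ]; exact hB.le_top 0 i))
    · simp
    · simpa using hB.le_top j i
  · rintro (_ | j) (_ | i)
    · simpa using hgL
    · simpa [hκ] using hγ i
    · simp
    · simpa using hB.mono j i
  · rintro (_ | j) (_ | i)
    · simpa [hκ] using hg
    · cases i with
      | zero => simpa [hκ] using h1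
      | succ i =>
        have := (hB.mono 0 (i + 2)).trans (hB.strip 0 (i + 1))
        rw [hκ] at this
        simpa [hκ, hs] using this
    · simpa using (hB.le_top _ 0).trans hL
    · simpa using hB.strip j i
  · refine ⟨J + 1, fun j hj => ?_⟩
    simp only [show j ≠ 0 by omega, if_false]
    rw [hJ _ (by omega)]
  · refine ⟨N + 2, fun i hi => ?_, fun j I hI => ?_⟩
    · obtain ⟨i, rfl⟩ : ∃ b, i = b + 1 := ⟨i - 1, by omega⟩
      exact hN i (by omega)
    · obtain ⟨I, rfl⟩ : ∃ b, I = b + 2 := ⟨I - 2, by omega⟩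
      cases j with
      | zero =>
        have := hsumγ I
        simp only [zero_add, one_ne_zero, if_false, if_true, Nat.sub_self, sum_consPart, hκ,
          consPart_zero]
        omega
      | succ j =>
        have := hw j (I + 1) (by omega)
        simp only [Nat.succ_ne_zero, if_false, Nat.add_sub_cancel, sum_consPart,
          consPart_succ]
        omega
  · rintro (_ | j) i
    · simp only [zero_add, one_ne_zero, OfNat.ofNat_ne_zero, if_false, if_true, Nat.sub_self, hκ,
        sum_consPart, show 2 - 1 = 1 from rfl]
      rcases i with _ | _ | i
      · simp
      · have := hpart 1
        simp only [Finset.sum_range_one, zero_add, consPart_zero] at this ⊢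
        omega
      · have := hpart (i + 1 + 1)
        have := hsumγ i
        simp only [sum_consPart]
        omega
    · simp only [Nat.succ_ne_zero, if_false, sum_consPart, Nat.add_sub_cancel,
        show j + 1 + 2 = (j + 2) + 1 from rfl]
      cases i with
      | zero => simp
      | succ i =>
        have := hB.lattice j i
        simp only [sum_consPart]
        omega

/-! ### Bounds forced by positivity -/

theorem exists_filling_of_LRcoeff_pos {l m ν : ℕ → ℕ} (h : 0 < LRcoeff l m ν) :
    ∃ T, IsLRFilling (skewCells l m) ν T := by
  by_contra hc
  have : {T : ℕ × ℕ → ℕ | (∀ i, m i ≤ l i) ∧ (∀ c, c ∉ skewCells l m → T c = 0) ∧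
      IsLRFilling (skewCells l m) ν T} = ∅ := by
    ext T
    simp only [Set.mem_ofPred_eq, Set.mem_empty_iff_false, iff_false]
    exact fun hT => hc ⟨T, hT.2.2⟩
  rw [LRcoeff, this, Set.ncard_empty] at h
  omega

theorem finite_skewCells {l : ℕ → ℕ} (hl : IsPartition l) (m : ℕ → ℕ) :
    (skewCells l m).Finite := by
  obtain ⟨-, N, hN⟩ := hl
  refine (finite_between m l N).subset fun p hp => ⟨?_, hp.1, hp.2⟩
  by_contra hc
  have h2 := hp.2
  rw [hN _ (not_lt.1 hc)] at h2
  omega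

theorem row_le_of_LRcoeff_pos {l m ν : ℕ → ℕ} (hl : IsPartition l) (h : 0 < LRcoeff l m ν) :
    l 0 ≤ m 0 + ν 0 := by
  obtain ⟨T, hT⟩ := exists_filling_of_LRcoeff_pos h
  by_cases hml : l 0 ≤ m 0
  · omega
  have hlast : (0, l 0 - 1) ∈ skewCells l m :=
    ⟨show m 0 ≤ l 0 - 1 by omega, show l 0 - 1 < l 0 by omega⟩
  have honly : ∀ d ∈ skewCells l m, readBefore d (0, l 0 - 1) → d = (0, l 0 - 1) := by
    rintro ⟨a, b⟩ ⟨h1, h2⟩ (h | ⟨h3, h4⟩)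
    · simp at h
    · simp only at h1 h2 h3 h4
      subst h3
      ext <;> simp
      omega
  have hlast1 : T (0, l 0 - 1) ≤ 1 := by
    by_contra hc
    obtain ⟨t, ht⟩ : ∃ t, T (0, l 0 - 1) = t + 1 + 1 := ⟨T (0, l 0 - 1) - 2, by omega⟩
    have h1 := hT.lattice _ hlast (t + 1) (by omega)
    have e1 : {d ∈ skewCells l m | T d = t + 1 + 1 ∧ readBefore d (0, l 0 - 1)} =
        {(0, l 0 - 1)} := by
      ext d
      constructor
      · exact fun hd => honly d hd.1 hd.2.2
      · rintro rfl
        exact ⟨hlast, ht, Or.inr ⟨rfl, le_rfl⟩⟩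
    have e2 : {d ∈ skewCells l m | T d = t + 1 ∧ readBefore d (0, l 0 - 1)} = ∅ := by
      ext d
      simp only [Set.mem_ofPred_eq, Set.mem_empty_iff_false, iff_false]
      rintro ⟨h1, h2, h3⟩
      rw [honly d h1 h3] at h2
      omega
    rw [e1, e2, Set.ncard_singleton, Set.ncard_empty] at h1
    omega
  have hsub : (fun b => ((0 : ℕ), b)) '' Set.Ico (m 0) (l 0) ⊆ {c ∈ skewCells l m | T c = 1} := by
    rintro _ ⟨b, ⟨hb1, hb2⟩, rfl⟩
    have hb : (0, b) ∈ skewCells l m := ⟨hb1, hb2⟩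
    refine ⟨hb, le_antisymm ?_ (hT.pos _ hb)⟩
    exact (hT.row_weak 0 b (l 0 - 1) hb hlast (by omega)).trans hlast1
  have h1 := Set.ncard_le_ncard hsub ((finite_skewCells hl m).subset fun d hd => hd.1)
  rw [hT.weight 1 le_rfl, Set.ncard_image_of_injective _ (Prod.mk_right_injective 0),
    Set.ncard_eq_toFinset_card'] at h1
  simp at h1
  omega

theorem IsPartition.finite_support {f : ℕ → ℕ} (hf : IsPartition f) (j : ℕ) :
    {i | j < f i}.Finite := by
  obtain ⟨-, N, hN⟩ := hf
  refine (Set.finite_Iio N).subset fun i hi => ?_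
  by_contra hc
  have h1 : j < f i := hi
  rw [hN i (not_lt.1 hc)] at h1
  omega

theorem col_le_of_LRcoeff_pos {l m ν : ℕ → ℕ} (hl : IsPartition l) (hm : IsPartition m)
    (hν : IsPartition ν) (h : 0 < LRcoeff l m ν) :
    conj l 0 ≤ conj m 0 + conj ν 0 := by
  obtain ⟨T, hT⟩ := exists_filling_of_LRcoeff_pos h
  have hfin := finite_skewCells hl m
  have hcell : ∀ i ∈ {i | m i = 0 ∧ 0 < l i}, (i, 0) ∈ skewCells l m :=
    fun i hi => ⟨show m i ≤ 0 from hi.1.le, hi.2⟩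
  have hsub : {i | 0 < l i} ⊆ {i | 0 < m i} ∪ {i | m i = 0 ∧ 0 < l i} := by
    intro i hi
    rcases Nat.eq_zero_or_pos (m i) with h0 | h0
    · exact Or.inr ⟨h0, hi⟩
    · exact Or.inl h0
  have hfin2 : {i | m i = 0 ∧ 0 < l i}.Finite := (hl.finite_support 0).subset fun i hi => hi.2
  have h1 := Set.ncard_le_ncard hsub ((hm.finite_support 0).union hfin2)
  have h2 := Set.ncard_union_le {i | 0 < m i} {i | m i = 0 ∧ 0 < l i}
  have h3 : Set.ncard {i | m i = 0 ∧ 0 < l i} ≤ Set.ncard {i | 0 < ν i} := by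
    refine Set.ncard_le_ncard_of_injOn (fun i => T (i, 0) - 1) (fun i hi => ?_)
      (fun i hi i' hi' hii => ?_) (hν.finite_support 0)
    · have hc := hcell i hi
      have := hT.weight (T (i, 0)) (hT.pos _ hc)
      change 0 < ν (T (i, 0) - 1)
      rw [← this, Set.ncard_pos (hfin.subset fun d hd => hd.1)]
      exact ⟨_, hc, rfl⟩
    · have hc := hcell i hi
      have hc' := hcell i' hi'
      have := hT.pos _ hc
      have := hT.pos _ hc'
      simp only at hii
      rcases lt_trichotomy i i' with hlt | heq | hlt
      · have := hT.col_strict _ _ _ hc hc' hlt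
        omega
      · exact heq
      · have := hT.col_strict _ _ _ hc' hc hlt
        omega
  simp only [conj]
  omega

/-! ### Iterated coefficients with three factors -/

theorem finite_partitions (n : ℕ) : Finite {g : ℕ → ℕ // IsPartition g ∧ psize g = n} := by
  refine ((finite_bounded_support (Set.finite_Iio n) n).subset ?_ :
    {g : ℕ → ℕ | IsPartition g ∧ psize g = n}.Finite)
  rintro g ⟨⟨ha, N, hN⟩, hs⟩
  rw [psize_eq_sum hN] at hs
  refine ⟨fun c hc => ?_, fun c _ => ?_⟩
  · by_contra h0
    have hcn : n ≤ c := by simpa using hc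
    have hcN : c < N := by
      by_contra hlt
      exact h0 (hN c (not_lt.1 hlt))
    have h1 : ∑ i ∈ Finset.range (c + 1), 1 ≤ ∑ i ∈ Finset.range (c + 1), g i := by
      refine Finset.sum_le_sum fun i hi => ?_
      have := ha (show i ≤ c by simpa [Nat.lt_succ_iff] using hi)
      omega
    have h2 : ∑ i ∈ Finset.range (c + 1), g i ≤ ∑ i ∈ Finset.range N, g i :=
      Finset.sum_le_sum_of_subset (by simpa using hcN)
    simp at h1
    omega
  · have := le_sum_of_support hN c
    omega

theorem iterLR_cons_cons (a b : ℕ → ℕ) (μs : List (ℕ → ℕ)) (l : ℕ → ℕ) :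
    iterLR (a :: b :: μs) l =
      ∑' g : {g : ℕ → ℕ // IsPartition g ∧ psize g = ((b :: μs).map psize).sum},
        iterLR (b :: μs) g.1 * LRcoeff l g.1 a := by
  rw [iterLR]
  simp

theorem iterLR_cons_cons_pos {a b : ℕ → ℕ} {μs : List (ℕ → ℕ)} {l : ℕ → ℕ} :
    0 < iterLR (a :: b :: μs) l ↔ ∃ g, (IsPartition g ∧ psize g = ((b :: μs).map psize).sum) ∧
      0 < iterLR (b :: μs) g ∧ 0 < LRcoeff l g a := by
  rw [iterLR_cons_cons]
  have := finite_partitions ((b :: μs).map psize).sum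
  have := Fintype.ofFinite {g : ℕ → ℕ // IsPartition g ∧ psize g = ((b :: μs).map psize).sum}
  rw [tsum_fintype, Finset.sum_pos_iff]
  constructor
  · rintro ⟨⟨g, hg⟩, -, h⟩
    exact ⟨g, hg, Nat.pos_of_mul_pos_right h, Nat.pos_of_mul_pos_left h⟩
  · rintro ⟨g, hg, h1, h2⟩
    exact ⟨⟨g, hg⟩, Finset.mem_univ _, Nat.mul_pos h1 h2⟩

theorem iterLR_three_pos {a b c l : ℕ → ℕ} (hc : IsPartition c) :
    0 < iterLR [a, b, c] l ↔ ∃ g, IsPartition g ∧ psize g = psize b + psize c ∧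
      0 < LRcoeff g c b ∧ 0 < LRcoeff l g a := by
  rw [iterLR_cons_cons_pos]
  refine exists_congr fun g => ?_
  have : 0 < iterLR [b, c] g ↔ 0 < LRcoeff g c b := by
    rw [iterLR_cons_cons_pos]
    constructor
    · rintro ⟨g', -, h1, h2⟩
      have : g' = c := by
        by_contra hne
        simp [iterLR, hne] at h1
      rwa [← this]
    · exact fun h => ⟨c, ⟨hc, by simp⟩, by simp [iterLR], h⟩
  rw [this]
  simp [and_assoc]

/-- Membership in `Dset 3 n B` from a pair of chains. -/
theorem mem_Dset_three {n : ℕ} {B : Set (ℕ → ℕ)} {l g a b c : ℕ → ℕ} (hl : l ∈ Pset (3 * n))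
    (hB : B ⊆ Pset n) (ha : a ∈ B) (hb : b ∈ B) (hc : c ∈ B) (hne : a ≠ b ∨ b ≠ c)
    (hg : IsPartition g) (hgn : psize g = 2 * n) (h1 : HasLRChain g c b)
    (h2 : HasLRChain l g a) : l ∈ Dset 3 n B := by
  refine ⟨hl, ![a, b, c], ?_, ?_, ?_⟩
  · intro i
    fin_cases i <;> assumption
  · rcases hne with h | h
    · exact ⟨0, 1, h⟩
    · exact ⟨1, 2, h⟩
  · have : List.ofFn ![a, b, c] = [a, b, c] := by simp [List.ofFn_succ]
    rw [this, iterLR_three_pos (hB hc).1]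
    refine ⟨g, hg, ?_, h1.choose_spec.pos, h2.choose_spec.pos⟩
    rw [hgn, (hB hb).2, (hB hc).2]
    omega

theorem bounds_of_iterLR_three {a b c l : ℕ → ℕ} (hl : IsPartition l) (ha : IsPartition a)
    (hb : IsPartition b) (hc : IsPartition c) (h : 0 < iterLR [a, b, c] l) :
    l 0 ≤ a 0 + b 0 + c 0 ∧ conj l 0 ≤ conj a 0 + conj b 0 + conj c 0 := by
  obtain ⟨g, hg, -, h1, h2⟩ := (iterLR_three_pos hc).1 h
  have := row_le_of_LRcoeff_pos hg h1
  have := row_le_of_LRcoeff_pos hl h2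
  have := col_le_of_LRcoeff_pos hg hc hb h1
  have := col_le_of_LRcoeff_pos hl hg ha h2
  omega

/-! ### The allowed set of partitions -/

/-- The set of allowed partitions of `2m - 5`, in terms of `m = 3r + 1`. -/
noncomputable def allowedSet (m : ℕ) : Set (ℕ → ℕ) :=
  Bset (2 * m - 5) (m + 2) \ conjClosure
    {ofList [m + 1, m - 6], hookP (m + 1) (m - 6), ofList [m - 2, m - 3]}

theorem allowedSet_subset (m : ℕ) : allowedSet m ⊆ Pset (2 * m - 5) := fun _ h => h.1.1

theorem ofList_pair_support (a b : ℕ) : ∀ c, 2 ≤ c → ofList [a, b] c = 0 := by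
  intro c hc
  obtain ⟨c, rfl⟩ : ∃ d, c = d + 2 := ⟨c - 2, by omega⟩
  simp [ofList]

theorem conj_ofList_pair (a b j : ℕ) :
    conj (ofList [a, b]) j = (if j < a then 1 else 0) + (if j < b then 1 else 0) := by
  rw [conj_eq_sum (ofList_pair_support a b)]
  simp only [Finset.sum_range_succ, Finset.sum_range_zero, zero_add]
  rfl

theorem isPartition_ofList_pair {a b : ℕ} (h : b ≤ a) : IsPartition (ofList [a, b]) := by
  refine ⟨antitone_nat_of_succ_le fun i => ?_, 2, ofList_pair_support a b⟩
  rcases i with _ | i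
  · exact h
  · rw [ofList_pair_support a b _ (by omega)]
    exact Nat.zero_le _

theorem hookP_succ (a b i : ℕ) : hookP a b (i + 1) = if i < b then 1 else 0 := by
  simp only [hookP, ofList, List.getD_cons_succ]
  split_ifs with h
  · rw [List.getD_eq_getElem _ _ (by simpa using h)]
    simp
  · rw [List.getD_eq_default _ _ (by simpa using h)]

theorem conj_hookP {a b : ℕ} (j : ℕ) :
    conj (hookP a b) j = (if j < 1 then b else 0) + (if j < a then 1 else 0) := by
  rw [conj_eq_sum (C := b + 1), Finset.sum_range_succ']
  · congr 1
    rw [Finset.sum_congr rfl (g := fun _ => if j < 1 then 1 else 0)]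
    · simp
    · intro i hi
      rw [hookP_succ, if_pos (show i < b by simpa using hi)]
  · intro c hc
    obtain ⟨c, rfl⟩ : ∃ d, c = d + 1 := ⟨c - 1, by omega⟩
    rw [hookP_succ, if_neg (by omega)]

/-- A sufficient criterion for membership in `allowedSet m`. -/
theorem mem_allowedSet {m : ℕ} {μ : ℕ → ℕ} (hm : 43 ≤ m) (hμ : IsPartition μ)
    (hs : psize μ = 2 * m - 5) (hrow : μ 0 ≤ m + 2) (hcol : μ (m + 2) = 0)
    (hA : μ 0 ≠ m + 1)
    (hτ : μ 0 = m - 2 → μ 1 ≠ m - 3 ∨ 1 ≤ μ 2)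
    (hH : μ 0 = 2 ∨ μ 0 = m - 5 → μ m = 0 ∨ 1 ≤ μ (m + 1))
    (hτ' : μ 0 = 2 → ∃ v, v < m - 3 ∧ μ v ≠ 2 ∨ 1 ≤ μ (m - 2)) : μ ∈ allowedSet m := by
  refine ⟨⟨⟨hμ, hs⟩, hrow, ?_⟩, ?_⟩
  · by_contra hc
    have := (lt_conj_iff hμ (m + 2) 0).1 (by omega)
    omega
  · rintro ((h | h | h) | ⟨_, h | h | h, rfl⟩) <;> subst h
    · exact hA (by simp [ofList])
    · exact hA (by simp [hookP, ofList])
    · have := hτ (by simp [ofList])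
      simp [ofList] at this
    · have := hH (Or.inl (by rw [conj_ofList_pair]; split_ifs <;> omega))
      simp only [conj_ofList_pair] at this
      split_ifs at this <;> omega
    · have := hH (Or.inr (by rw [conj_hookP]; split_ifs <;> omega))
      rw [conj_hookP, conj_hookP, if_neg (by omega), if_pos (by omega), if_neg (by omega),
        if_neg (by omega)] at this
      omega
    · obtain ⟨v, h | h⟩ := hτ' (by simp only [conj_ofList_pair]; split_ifs <;> omega)
      · simp only [conj_ofList_pair] at h
        split_ifs at h <;> omega
      · simp only [conj_ofList_pair] at h
        split_ifs at h <;> omega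

theorem conj_pos {f : ℕ → ℕ} {C : ℕ} (hf : ∀ c, C ≤ c → f c = 0) {v c : ℕ} (h : v < f c) :
    1 ≤ conj f v := by
  rw [conj_eq_sum hf, Nat.one_le_iff_ne_zero, ← Nat.pos_iff_ne_zero, Finset.sum_pos_iff]
  refine ⟨c, ?_, by simp [h]⟩
  by_contra hc
  rw [hf c (by simpa using hc)] at h
  omega

theorem conj_succ_lt {f : ℕ → ℕ} {C : ℕ} (hf : ∀ c, C ≤ c → f c = 0) {v c : ℕ}
    (h : f c = v + 1) : conj f (v + 1) < conj f v := by
  have hc : c < C := by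
    by_contra hc
    rw [hf c (by omega)] at h
    omega
  rw [conj_eq_sum hf, conj_eq_sum hf]
  refine Finset.sum_lt_sum (fun i _ => ?_) ⟨c, by simpa using hc, ?_⟩
  · split_ifs <;> omega
  · rw [if_neg (by omega), if_pos (by omega)]
    exact one_pos

/-- Column criterion for membership in `allowedSet m`. -/
theorem conj_mem_allowedSet {m C : ℕ} {f : ℕ → ℕ} (hm : 43 ≤ m) (hf : ∀ c, C ≤ c → f c = 0)
    (hs : ∑ c ∈ Finset.range C, f c = 2 * m - 5) (hcount : conj f 0 ≤ m)
    (htwo : conj f 0 ≤ m - 3 ∨ ∃ c, 3 ≤ f c) (hle : ∀ c, f c ≤ m + 2)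
    (hheight : (∀ c, f c ≤ m) ∨ ∃ c, f c = m + 2)
    (hcol : (∃ c, 1 ≤ f c ∧ f c ≤ m - 4) ∨ (∃ c, m - 2 < f c) ∨ conj f 0 ≠ 2) :
    conj f ∈ allowedSet m := by
  refine mem_allowedSet hm (isPartition_conj hf) (by rw [psize_conj hf, hs]) (by omega)
    (conj_eq_zero hle) (by omega) (fun h => ?_) (fun _ => ?_) (fun h => ?_)
  · obtain h' | ⟨c, hc⟩ := htwo
    · omega
    · exact Or.inr (conj_pos hf (c := c) (by omega))
  · obtain h' | ⟨c, hc⟩ := hheight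
    · exact Or.inl (conj_eq_zero h')
    · exact Or.inr (conj_pos hf (c := c) (by omega))
  · obtain ⟨c, h1, h2⟩ | ⟨c, hc⟩ | hc := hcol
    · have h3 := conj_succ_lt hf (v := f c - 1) (c := c) (by omega)
      rw [Nat.sub_add_cancel h1] at h3
      by_cases h4 : conj f (f c) = 2
      · exact ⟨f c - 1, Or.inl ⟨by omega, by omega⟩⟩
      · exact ⟨f c, Or.inl ⟨by omega, h4⟩⟩
    · exact ⟨0, Or.inr (conj_pos hf (c := c) (by omega))⟩
    · exact ⟨0, Or.inl ⟨by omega, hc⟩⟩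

/-! ### Splitting functions into pieces of prescribed size -/

theorem exists_le_sum_eq (g : ℕ → ℕ) (C D : ℕ) (h : D ≤ ∑ c ∈ Finset.range C, g c) :
    ∃ p : ℕ → ℕ, (∀ c, p c ≤ g c) ∧ ∑ c ∈ Finset.range C, p c = D := by
  induction C generalizing D with
  | zero => exact ⟨fun _ => 0, fun c => Nat.zero_le _, by simp at h ⊢; omega⟩
  | succ C ih =>
    rw [Finset.sum_range_succ] at h
    obtain ⟨p, hp, hs⟩ := ih (D - g C) (by omega)
    refine ⟨fun c => if c = C then min D (g C) else p c, fun c => ?_, ?_⟩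
    · dsimp only
      split_ifs with hc
      · rw [hc]; exact min_le_right _ _
      · exact hp c
    · rw [Finset.sum_range_succ, Finset.sum_congr rfl (g := p), hs]
      · simp only [if_true]; omega
      · intro c hc
        have : c ≠ C := by have := Finset.mem_range.1 hc; omega
        simp [this]

theorem exists_cut (g : ℕ → ℕ) (C a b d : ℕ) (h : ∑ c ∈ Finset.range C, g c = a + b + d) :
    ∃ p q o : ℕ → ℕ, (∀ c, p c + q c + o c = g c) ∧ ∑ c ∈ Finset.range C, p c = a ∧
      ∑ c ∈ Finset.range C, q c = b ∧ ∑ c ∈ Finset.range C, o c = d := by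
  obtain ⟨p, hp, hps⟩ := exists_le_sum_eq g C a (by omega)
  have h1 : ∑ c ∈ Finset.range C, (g c - p c) + ∑ c ∈ Finset.range C, p c =
      ∑ c ∈ Finset.range C, g c := by
    rw [← Finset.sum_add_distrib]
    exact Finset.sum_congr rfl fun c _ => Nat.sub_add_cancel (hp c)
  obtain ⟨q, hq, hqs⟩ := exists_le_sum_eq (fun c => g c - p c) C b (by omega)
  refine ⟨p, q, fun c => g c - p c - q c, fun c => ?_, hps, hqs, ?_⟩
  · have := hp c
    have := hq c
    dsimp only
    omega
  · have h2 : ∑ c ∈ Finset.range C, (g c - p c - q c) + ∑ c ∈ Finset.range C, q c =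
        ∑ c ∈ Finset.range C, (g c - p c) := by
      rw [← Finset.sum_add_distrib]
      exact Finset.sum_congr rfl fun c _ => Nat.sub_add_cancel (hq c)
    dsimp only
    omega

theorem support_of_sum {p q o h : ℕ → ℕ} {C : ℕ} (hsum : ∀ c, p c + q c + o c = h c)
    (hh : ∀ c, C ≤ c → h c = 0) :
    (∀ c, C ≤ c → p c = 0) ∧ (∀ c, C ≤ c → q c = 0) ∧ (∀ c, C ≤ c → o c = 0) := by
  refine ⟨fun c hc => ?_, fun c hc => ?_, fun c hc => ?_⟩ <;>
  · have := hsum c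
    have := hh c hc
    omega

theorem hasLRChain_columns {p q o h : ℕ → ℕ} {C : ℕ} (hsum : ∀ c, p c + q c + o c = h c)
    (hh : ∀ c, C ≤ c → h c = 0) :
    HasLRChain (conj fun c => o c + q c) (conj o) (conj q) ∧
      HasLRChain (conj h) (conj fun c => o c + q c) (conj p) := by
  obtain ⟨hp, hq, ho⟩ := support_of_sum hsum hh
  refine ⟨hasLRChain_conj_add hq ho, ?_⟩
  have := hasLRChain_conj_add (p := p) (q := fun c => o c + q c) hp
    (fun c hc => by rw [hq c hc, ho c hc])
  have he : (fun c => o c + q c + p c) = h := funext fun c => by rw [← hsum c]; omega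
  rwa [he] at this

theorem mem_Dset_of_columns {m : ℕ} {l p q o : ℕ → ℕ}
    (hl : l ∈ Pset (3 * (2 * m - 5)))
    (hsum : ∀ c, p c + q c + o c = conj l c) (hp : conj p ∈ allowedSet m)
    (hq : conj q ∈ allowedSet m) (ho : conj o ∈ allowedSet m)
    (hne : conj p ≠ conj q ∨ conj q ≠ conj o) : l ∈ Dset 3 (2 * m - 5) (allowedSet m) := by
  have hs := hl.1.conj_support
  obtain ⟨h1, h2⟩ := hasLRChain_columns hsum hs
  obtain ⟨sp, sq, so⟩ := support_of_sum hsum hs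
  have soq : ∀ c, l 0 ≤ c → o c + q c = 0 := fun c hc => by rw [sq c hc, so c hc]
  rw [conj_conj hl.1] at h2
  refine mem_Dset_three hl (allowedSet_subset m) hp hq ho hne (isPartition_conj soq) ?_ h1 h2
  have e1 := (allowedSet_subset m hq).2
  have e2 := (allowedSet_subset m ho).2
  rw [psize_conj sq] at e1
  rw [psize_conj so] at e2
  rw [psize_conj soq, Finset.sum_add_distrib]
  omega

theorem conj_zero_add_le {p q : ℕ → ℕ} {C : ℕ} (hp : ∀ c, C ≤ c → p c = 0)
    (hq : ∀ c, C ≤ c → q c = 0) : conj (fun c => p c + q c) 0 ≤ conj p 0 + conj q 0 := by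
  rw [conj_eq_sum hp, conj_eq_sum hq, conj_eq_sum (C := C)
    fun c hc => by rw [hp c hc, hq c hc], ← Finset.sum_add_distrib]
  refine Finset.sum_le_sum fun c _ => ?_
  split_ifs <;> omega

/-- The partition obtained by deleting the first part. -/
def tailPart (l : ℕ → ℕ) : ℕ → ℕ := fun i => l (i + 1)

theorem consPart_tailPart (l : ℕ → ℕ) : consPart (l 0) (tailPart l) = l := by
  funext i
  cases i <;> rfl

theorem IsPartition.tailPart {l : ℕ → ℕ} (hl : IsPartition l) : IsPartition (tailPart l) := by
  obtain ⟨ha, N, hN⟩ := hl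
  exact ⟨fun i j hij => ha (by omega), N, fun i hi => hN _ (by omega)⟩

theorem psize_tailPart {l : ℕ → ℕ} (hl : IsPartition l) :
    psize l = l 0 + psize (tailPart l) := by
  conv_lhs => rw [← consPart_tailPart l]
  exact psize_consPart hl.tailPart

theorem HasLRChain.consPart_zero_shift {ρ κ δ : ℕ → ℕ} {g k : ℕ} (h : HasLRChain ρ κ δ)
    (hκ : IsPartition κ) (hg : κ 0 ≤ g) (hL : ρ 0 ≤ g + k) (hδ : δ 0 ≤ k) :
    HasLRChain (SylowBranching.consPart (g + k) ρ) (SylowBranching.consPart g κ)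
      (SylowBranching.consPart k δ) :=
  h.consPart (u := 0) rfl (fun _ => rfl) (hκ.1 (Nat.zero_le 1)) rfl hg (by omega) hL hδ

theorem mem_Dset_of_row_columns {m : ℕ} {l p q o : ℕ → ℕ} {a b d : ℕ}
    (hl : l ∈ Pset (3 * (2 * m - 5))) (hrow : l 0 = a + b + d)
    (hsum : ∀ c, p c + q c + o c = conj (tailPart l) c)
    (hp : consPart a (conj p) ∈ allowedSet m) (hq : consPart b (conj q) ∈ allowedSet m)
    (ho : consPart d (conj o) ∈ allowedSet m) (hne : a ≠ b ∨ b ≠ d) :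
    l ∈ Dset 3 (2 * m - 5) (allowedSet m) := by
  have hs := hl.1.tailPart.conj_support
  obtain ⟨h1, h2⟩ := hasLRChain_columns hsum hs
  obtain ⟨sp, sq, so⟩ := support_of_sum hsum hs
  have soq : ∀ c, tailPart l 0 ≤ c → o c + q c = 0 := fun c hc => by rw [sq c hc, so c hc]
  rw [conj_conj hl.1.tailPart] at h2
  have ep : conj p 0 ≤ a := (allowedSet_subset m hp).1.1 (Nat.zero_le 1)
  have eq : conj q 0 ≤ b := (allowedSet_subset m hq).1.1 (Nat.zero_le 1)
  have eo : conj o 0 ≤ d := (allowedSet_subset m ho).1.1 (Nat.zero_le 1)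
  have := conj_zero_add_le so sq
  have h1' := h1.consPart_zero_shift (g := d) (k := b) (isPartition_conj so) eo (by omega) eq
  have hl01 := hl.1.1 (Nat.zero_le 1)
  have h2' := h2.consPart_zero_shift (g := d + b) (k := a) (isPartition_conj soq) (by omega)
    (show l 1 ≤ _ by omega) ep
  rw [show d + b + a = l 0 by omega, consPart_tailPart] at h2'
  refine mem_Dset_three hl (allowedSet_subset m) hp hq ho ?_
    (isPartition_consPart (isPartition_conj soq) (by omega)) ?_ h1' h2'
  · refine hne.imp (fun h h' => h (congrFun h' 0)) (fun h h' => h (congrFun h' 0))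
  · have e1 := (allowedSet_subset m hq).2
    have e2 := (allowedSet_subset m ho).2
    rw [psize_consPart (isPartition_conj sq), psize_conj sq] at e1
    rw [psize_consPart (isPartition_conj so), psize_conj so] at e2
    rw [psize_consPart (isPartition_conj soq), psize_conj soq, Finset.sum_add_distrib]
    omega

/-- Prepending two rows to a chain, with `u` cells of the weight's first row placed in the
second row. -/
theorem HasLRChain.consPart_consPart {ρ κ δ : ℕ → ℕ} {L L' G G' k k' u : ℕ}
    (h : HasLRChain ρ κ δ) (hκp : IsPartition κ) (hκ : κ 0 ≤ G') (hδ : δ 0 ≤ k')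
    (hρ : ρ 0 ≤ L') (hL' : L' = G' + u + k') (hL : L + u = G + k) (hG : G' + u ≤ G)
    (hLL : L' ≤ L) (hk : k' + u ≤ k) :
    HasLRChain (SylowBranching.consPart L (SylowBranching.consPart L' ρ))
      (SylowBranching.consPart G (SylowBranching.consPart G' κ))
      (SylowBranching.consPart k (SylowBranching.consPart k' δ)) := by
  have h1 := h.consPart_zero_shift (g := G' + u) (k := k') hκp (by omega) (by omega) hδ
  rw [← hL'] at h1
  exact h1.consPart (u := u) rfl (fun _ => rfl) hκ hL hG (by omega) hLL hk

theorem sum_range_conj_eq_psize {l : ℕ → ℕ} (hl : IsPartition l) {C : ℕ} (h : l 0 ≤ C) :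
    ∑ c ∈ Finset.range C, conj l c = psize l := by
  rw [← psize_conj fun c hc => hl.conj_support c (h.trans hc), conj_conj hl]

theorem sum_conj_eq_psize {l : ℕ → ℕ} (hl : IsPartition l) :
    ∑ c ∈ Finset.range (l 0), conj l c = psize l :=
  sum_range_conj_eq_psize hl le_rfl

theorem conj_zero_le_sum {f : ℕ → ℕ} {C : ℕ} (hf : ∀ c, C ≤ c → f c = 0) :
    conj f 0 ≤ ∑ c ∈ Finset.range C, f c := by
  rw [conj_eq_sum hf]
  refine Finset.sum_le_sum fun c _ => ?_
  split_ifs <;> omega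

theorem conj_tailPart {l : ℕ → ℕ} (hl : IsPartition l) (c : ℕ) :
    conj (tailPart l) c = conj l c - 1 := by
  refine eq_of_forall_lt_iff fun i => ?_
  rw [lt_conj_iff hl.tailPart, show tailPart l i = l (i + 1) from rfl, ← lt_conj_iff hl]
  omega

/-- Criterion for membership in `allowedSet m` of a partition with a long first row. -/
theorem consPart_mem_allowedSet {m C k : ℕ} {f : ℕ → ℕ} (hm : 43 ≤ m)
    (hf : ∀ c, C ≤ c → f c = 0) (hs : k + ∑ c ∈ Finset.range C, f c = 2 * m - 5)
    (hk : m - 9 ≤ k) (hk' : k ≤ m ∨ k = m + 2) (hcount : conj f 0 ≤ k)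
    (hle : ∀ c, f c ≤ m + 1) (hτ : k = m - 2 → conj f 0 ≠ m - 3)
    (hH : k = m - 5 → ∀ c, f c ≤ m - 1) : consPart k (conj f) ∈ allowedSet m := by
  refine mem_allowedSet hm (isPartition_consPart (isPartition_conj hf) hcount)
    (by rw [psize_consPart (isPartition_conj hf), psize_conj hf, hs])
    (by rw [consPart_zero]; omega) (conj_eq_zero hle) (by rw [consPart_zero]; omega)
    (fun h => Or.inl (hτ h)) (fun h => Or.inl ?_) (fun h => ?_)
  · rw [consPart_zero] at h
    obtain ⟨v, rfl⟩ : ∃ v, m = v + 1 := ⟨m - 1, by omega⟩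
    exact conj_eq_zero (hH (by omega))
  · rw [consPart_zero] at h
    omega

theorem mem_Dset_of_long_row {m : ℕ} {l : ℕ → ℕ} (hm : 43 ≤ m)
    (hl : l ∈ Pset (3 * (2 * m - 5))) (h1 : l 0 ≤ 3 * m + 2) (h2 : 3 * m - 2 ≤ l 0) :
    l ∈ Dset 3 (2 * m - 5) (allowedSet m) := by
  obtain ⟨a, b, d, hsum, ha, hb, hd, hne⟩ : ∃ a b d, l 0 = a + b + d ∧
      (a = m + 2 ∨ a = m ∨ a = m - 1) ∧ (b = m + 2 ∨ b = m ∨ b = m - 1) ∧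
      (d = m + 2 ∨ d = m ∨ d = m - 1) ∧ (a ≠ b ∨ b ≠ d) := by
    obtain h | h | h | h | h : l 0 = 3 * m + 2 ∨ l 0 = 3 * m + 1 ∨ l 0 = 3 * m ∨
      l 0 = 3 * m - 1 ∨ l 0 = 3 * m - 2 := by omega
    · exact ⟨m + 2, m, m, by omega⟩
    · exact ⟨m + 2, m, m - 1, by omega⟩
    · exact ⟨m + 2, m - 1, m - 1, by omega⟩
    · exact ⟨m, m, m - 1, by omega⟩
    · exact ⟨m, m - 1, m - 1, by omega⟩
  have hρ := hl.1.tailPart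
  have hsz := psize_tailPart hl.1
  rw [hl.2] at hsz
  obtain ⟨p, q, o, hpqo, hp, hq, ho⟩ := exists_cut (conj (tailPart l)) (tailPart l 0)
    (2 * m - 5 - a) (2 * m - 5 - b) (2 * m - 5 - d) (by rw [sum_conj_eq_psize hρ]; omega)
  obtain ⟨sp, sq, so⟩ := support_of_sum hpqo hρ.conj_support
  have key : ∀ (f : ℕ → ℕ) (k : ℕ), (∀ c, tailPart l 0 ≤ c → f c = 0) →
      (k = m + 2 ∨ k = m ∨ k = m - 1) →
      ∑ c ∈ Finset.range (tailPart l 0), f c = 2 * m - 5 - k →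
      consPart k (conj f) ∈ allowedSet m := by
    intro f k hf hk hs
    have := conj_zero_le_sum hf
    exact consPart_mem_allowedSet hm hf (by omega) (by omega) (by omega) (by omega)
      (fun c => by have := le_sum_of_support hf c; omega) (by omega) (by omega)
  exact mem_Dset_of_row_columns hl hsum hpqo (key p a sp ha hp) (key q b sq hb hq)
    (key o d so hd ho) hne

theorem exists_two_row_sizes {m L M E : ℕ} (hm : 43 ≤ m) (hE : L + M + E = 6 * m - 15)
    (h1 : L ≤ 3 * m - 3) (h2 : 3 * m - 25 ≤ L) (h3 : 2 * m ≤ M) (h4 : M ≤ L) :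
    ∃ e₀ e₁ e₂ l₀ l₁ l₂ s₁ s₂ G, E = e₀ + e₁ + e₂ ∧ (l₀ + e₀ = m - 5 ∧ l₁ + e₁ = m - 5 ∧
      l₂ + e₂ = m - 4) ∧ (e₀ ≤ l₀ ∧ e₁ ≤ l₁ ∧ e₂ ≤ l₂) ∧ (G + s₁ = m + m ∧ l₀ + s₁ ≤ m ∧
      l₀ + s₁ + l₁ ≤ G ∧ l₁ + s₁ ≤ m) ∧ M = l₀ + s₁ + l₁ + s₂ + l₂ ∧ L + s₂ = G + (m - 1) ∧
      l₀ + s₁ + l₁ + s₂ ≤ G ∧ l₂ + s₂ ≤ m - 1 := by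
  obtain ⟨e, he⟩ : ∃ e, E = 3 * e ∨ E = 3 * e + 1 ∨ E = 3 * e + 2 := ⟨E / 3, by omega⟩
  obtain ⟨e₁, e₂, he1, he2, h12⟩ : ∃ e₁ e₂, e ≤ e₁ ∧ E = e + e₁ + e₂ ∧ e₁ ≤ e₂ ∧ e₂ ≤ e + 1 := by
    obtain h | h | h := he
    · exact ⟨e, e, by omega⟩
    · exact ⟨e, e + 1, by omega⟩
    · exact ⟨e + 1, e + 1, by omega⟩
  clear he
  obtain ⟨x, rfl⟩ : ∃ x, m = x + 43 := ⟨m - 43, by omega⟩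
  by_cases hs : 3 * x + 128 - L ≤ 3 + e₂
  · refine ⟨e, e₁, e₂, x + 38 - e, x + 38 - e₁, x + 39 - e₂, 0, 3 * x + 128 - L,
      2 * x + 86, ?_⟩
    omega
  · refine ⟨e, e₁, e₂, x + 38 - e, x + 38 - e₁, x + 39 - e₂, 3 * x + 128 - L - (3 + e₂), 3 + e₂,
      2 * x + 86 - (3 * x + 128 - L - (3 + e₂)), ?_⟩
    omega

theorem consPart_consPart_mem_allowedSet {m C k k' : ℕ} {f : ℕ → ℕ} (hm : 43 ≤ m)
    (hf : ∀ c, C ≤ c → f c = 0) (hk : k = m ∨ k = m - 1)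
    (hs : k + k' + ∑ c ∈ Finset.range C, f c = 2 * m - 5)
    (hk' : ∑ c ∈ Finset.range C, f c ≤ k') :
    consPart k (consPart k' (conj f)) ∈ allowedSet m := by
  have hf1 := isPartition_consPart (a := k') (isPartition_conj hf)
    ((conj_zero_le_sum hf).trans hk')
  have hz : (consPart k (consPart k' (conj f))) 0 = k := rfl
  refine mem_allowedSet hm (isPartition_consPart hf1 (by rw [consPart_zero]; omega))
    (by rw [psize_consPart hf1, psize_consPart (isPartition_conj hf), psize_conj hf]; omega)
    (by omega) (conj_eq_zero fun c => ?_) (by omega) (by omega) (by omega) (by omega)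
  have := le_sum_of_support hf c
  omega

/-- Two long rows. -/
theorem mem_Dset_of_two_long_rows {m : ℕ} {l : ℕ → ℕ} (hm : 43 ≤ m)
    (hl : l ∈ Pset (3 * (2 * m - 5))) (h1 : l 0 ≤ 3 * m - 3) (h2 : 3 * m - 25 ≤ l 0)
    (h3 : 2 * m ≤ l 1) : l ∈ Dset 3 (2 * m - 5) (allowedSet m) := by
  have hρ := hl.1.tailPart
  have hρ' := hρ.tailPart
  have hsz := psize_tailPart hl.1
  rw [hl.2, psize_tailPart hρ, show tailPart l 0 = l 1 from rfl] at hsz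
  have h10 : l 1 ≤ l 0 := hl.1.1 (Nat.zero_le 1)
  have h21 : tailPart (tailPart l) 0 ≤ l 1 := hl.1.1 (show 1 ≤ 2 by omega)
  obtain ⟨e₀, e₁, e₂, l₀, l₁, l₂, s₁, s₂, G, hE, ⟨a0, a1, a2⟩, ⟨b0, b1, b2⟩, ⟨d0, d1, d2, d3⟩,
    f0, f1, f2, f3⟩ := exists_two_row_sizes (E := psize (tailPart (tailPart l))) hm (by omega)
      h1 h2 h3 h10
  clear hsz h1 h2 h3
  obtain ⟨p, q, o, hpqo, hp, hq, ho⟩ := exists_cut (conj (tailPart (tailPart l)))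
    (tailPart (tailPart l) 0) e₀ e₁ e₂ (by rw [sum_conj_eq_psize hρ', hE])
  obtain ⟨sp, sq, so⟩ := support_of_sum hpqo hρ'.conj_support
  obtain ⟨c1, c2⟩ := hasLRChain_columns (p := o) (q := q) (o := p)
    (h := conj (tailPart (tailPart l))) (fun c => by rw [← hpqo c]; omega) hρ'.conj_support
  rw [conj_conj hρ'] at c2
  have spq : ∀ c, tailPart (tailPart l) 0 ≤ c → p c + q c = 0 :=
    fun c hc => by rw [sp c hc, sq c hc]
  have np : conj p 0 ≤ l₀ := (conj_zero_le_sum sp).trans (hp.trans_le b0)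
  have nq : conj q 0 ≤ l₁ := (conj_zero_le_sum sq).trans (hq.trans_le b1)
  have no : conj o 0 ≤ l₂ := (conj_zero_le_sum so).trans (ho.trans_le b2)
  have npq : conj (fun c => p c + q c) 0 ≤ l₀ + s₁ + l₁ := by
    have := conj_zero_add_le sp sq
    omega
  have c1' := c1.consPart_consPart (isPartition_conj sp) np nq npq rfl d0 d1 d2 d3
  have c2' := c2.consPart_consPart (isPartition_conj spq) npq no h21 f0 f1 f2 h10 f3
  have ht : consPart (l 0) (consPart (l 1) (tailPart (tailPart l))) = l := by
    rw [show l 1 = tailPart l 0 from rfl, consPart_tailPart, consPart_tailPart]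
  rw [ht] at c2'
  have hg1 := isPartition_consPart (isPartition_conj spq) npq
  refine mem_Dset_three hl (allowedSet_subset m)
    (consPart_consPart_mem_allowedSet hm so (Or.inr rfl) (by omega) (by omega))
    (consPart_consPart_mem_allowedSet hm sq (Or.inl rfl) (by omega) (by omega))
    (consPart_consPart_mem_allowedSet hm sp (Or.inl rfl) (by omega) (by omega))
    (Or.inl fun h => ?_) (isPartition_consPart hg1 (by rw [consPart_zero]; exact d2)) ?_ c1' c2'
  · have := congrFun h 0
    simp only [consPart_zero] at this
    omega
  · rw [psize_consPart hg1, psize_consPart (isPartition_conj spq), psize_conj spq,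
      Finset.sum_add_distrib, hp, hq]
    omega

theorem sum_split_two (f : ℕ → ℕ) (C : ℕ) :
    ∑ c ∈ Finset.range (C + 2), f c = f 0 + f 1 + ∑ c ∈ Finset.range C, f (c + 2) := by
  rw [Finset.sum_range_succ', Finset.sum_range_succ', zero_add, add_assoc, add_comm (f 1),
    add_comm]

theorem le_sum_sub_of_ne_zero {f : ℕ → ℕ} {C : ℕ} (hf : ∀ c, C + 2 ≤ c → f c = 0) {c : ℕ}
    (hc : c ≠ 0) : f c + f 0 ≤ ∑ c ∈ Finset.range (C + 2), f c := by
  rw [sum_split_two]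
  obtain ⟨c, rfl⟩ : ∃ d, c = d + 1 := ⟨c - 1, by omega⟩
  rcases c with _ | c
  · simp only [zero_add]
    omega
  · have := le_sum_of_support (f := fun c => f (c + 2)) (C := C) (fun c hc => hf _ (by omega)) c
    rw [show c + 1 + 1 = c + 2 from rfl]
    omega

/-- Criterion for membership in `allowedSet m` of a partition with a long first column. -/
theorem conj_mem_allowedSet_of_tall {m C : ℕ} {f : ℕ → ℕ} (hm : 43 ≤ m)
    (hf : ∀ c, C + 2 ≤ c → f c = 0) (hs : ∑ c ∈ Finset.range (C + 2), f c = 2 * m - 5)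
    (hx : f 0 = m + 2 ∨ f 0 = m ∨ f 0 = m - 1 ∨ f 0 = m - 4 ∨ f 0 = m - 5 ∧ 2 ≤ f 1) :
    conj f ∈ allowedSet m := by
  have hle : ∀ c, c ≠ 0 → f c + f 0 ≤ 2 * m - 5 := fun c hc =>
    hs ▸ le_sum_sub_of_ne_zero hf hc
  have hcount : conj f 0 + f 0 + f 1 ≤ 2 * m - 5 + 1 + min (f 1) 1 := by
    have h1 := conj_eq_sum hf 0
    rw [sum_split_two] at h1 hs
    have h2 : (∑ c ∈ Finset.range C, if 0 < f (c + 2) then 1 else 0) ≤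
        ∑ c ∈ Finset.range C, f (c + 2) := by
      refine Finset.sum_le_sum fun c _ => ?_
      split_ifs <;> omega
    split_ifs at h1 <;> omega
  refine conj_mem_allowedSet hm hf hs (by omega) (Or.inr ⟨0, by omega⟩) (fun c => ?_) ?_ ?_
  · rcases Nat.eq_zero_or_pos c with rfl | hc
    · omega
    · have := hle c (by omega)
      omega
  · by_cases h0 : f 0 = m + 2
    · exact Or.inr ⟨0, h0⟩
    · refine Or.inl fun c => ?_
      rcases Nat.eq_zero_or_pos c with rfl | hc
      · omega
      · have := hle c (by omega)
        omega
  · by_cases h0 : f 0 ≤ m - 4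
    · exact Or.inl ⟨0, by omega, h0⟩
    · exact Or.inr (Or.inl ⟨0, by omega⟩)

theorem conj_ne_conj_of_height {f g : ℕ → ℕ} {C V c : ℕ} (hf : ∀ c, C ≤ c → f c = 0)
    (h1 : V < f c) (h2 : ∀ c, g c ≤ V) : conj f ≠ conj g := by
  intro h
  have := conj_pos hf h1
  rw [h, conj_eq_zero h2] at this
  omega

/-- The heights into which a long first column is cut. -/
theorem exists_tall_cut {m H : ℕ} (hm : 43 ≤ m) (h1 : 3 * m - 8 ≤ H) (h2 : H ≤ 3 * m + 2) :
    ∃ x y z, x + y + z = H ∧ (x = m + 2 ∨ x = m) ∧ (y = m ∨ y = m - 1 ∨ y = m - 4) ∧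
      (z = m ∨ z = m - 1 ∨ z = m - 4 ∨ z = m - 5 ∧ H = 3 * m - 7) ∧
      (x = m + 2 ∨ y ≤ m - 1 ∨ z ≤ m - 1 ∧ y = m ∧ m - 4 ≤ z) := by
  obtain h | h | h | h | h | h | h | h | h | h | h : H = 3 * m + 2 ∨ H = 3 * m + 1 ∨ H = 3 * m ∨
      H = 3 * m - 1 ∨ H = 3 * m - 2 ∨ H = 3 * m - 3 ∨ H = 3 * m - 4 ∨ H = 3 * m - 5 ∨
      H = 3 * m - 6 ∨ H = 3 * m - 7 ∨ H = 3 * m - 8 := by omega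
  · exact ⟨m + 2, m, m, by omega⟩
  · exact ⟨m + 2, m, m - 1, by omega⟩
  · exact ⟨m + 2, m - 1, m - 1, by omega⟩
  · exact ⟨m, m, m - 1, by omega⟩
  · exact ⟨m, m - 1, m - 1, by omega⟩
  · exact ⟨m + 2, m - 1, m - 4, by omega⟩
  · exact ⟨m, m, m - 4, by omega⟩
  · exact ⟨m, m - 1, m - 4, by omega⟩
  · exact ⟨m + 2, m - 4, m - 4, by omega⟩
  · exact ⟨m + 2, m - 4, m - 5, by omega⟩
  · exact ⟨m, m - 4, m - 4, by omega⟩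

/-- Splitting the columns of a diagram into three parts with prescribed sizes, prescribed pieces
of the first column and a prescribed share of the second one. -/
theorem exists_cut_first_column {h : ℕ → ℕ} {n C x y z w : ℕ}
    (hs : ∑ c ∈ Finset.range (C + 2), h c = 3 * n) (hxyz : x + y + z = h 0) (hw : w ≤ h 1)
    (hx : x ≤ n) (hy : y ≤ n) (hz : z + w ≤ n) :
    ∃ p q o : ℕ → ℕ, (∀ c, p c + q c + o c = h c) ∧ (p 0 = x ∧ q 0 = y ∧ o 0 = z ∧ w ≤ o 1) ∧
      ∑ c ∈ Finset.range (C + 2), p c = n ∧ ∑ c ∈ Finset.range (C + 2), q c = n ∧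
      ∑ c ∈ Finset.range (C + 2), o c = n := by
  have simp2 : ∀ c, (c + 2 = 1) = False := fun c => by simp
  rw [sum_split_two] at hs
  have hcut : ∑ c ∈ Finset.range (C + 2), (if c = 0 then 0 else if c = 1 then h 1 - w
      else h c) = (n - x) + (n - y) + (n - z - w) := by
    rw [sum_split_two]
    simp only [if_true, one_ne_zero, if_false, Nat.add_eq_zero_iff, OfNat.ofNat_ne_zero, and_false,
      simp2]
    omega
  obtain ⟨p, q, o, hpqo, hp, hq, ho⟩ := exists_cut _ _ _ _ _ hcut
  have h00 := hpqo 0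
  have h01 := hpqo 1
  simp only [if_true, one_ne_zero, if_false] at h00 h01
  refine ⟨fun c => if c = 0 then x else p c, fun c => if c = 0 then y else q c,
    fun c => if c = 0 then z else if c = 1 then o c + w else o c, fun c => ?_, ?_, ?_, ?_, ?_⟩
  · have := hpqo c
    dsimp only
    split_ifs at this ⊢ with h0 h1
    · subst h0
      exact hxyz
    · subst h1
      omega
    · exact this
  · simp
  all_goals
    rw [sum_split_two] at hp hq ho ⊢
    simp only [if_true, one_ne_zero, if_false, Nat.add_eq_zero_iff, OfNat.ofNat_ne_zero, and_false,
      simp2]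
    omega

theorem mem_Dset_of_tall {m : ℕ} {l : ℕ → ℕ} (hm : 43 ≤ m)
    (hl : l ∈ Pset (3 * (2 * m - 5))) (h1 : 3 * m - 8 ≤ conj l 0) (h2 : conj l 0 ≤ 3 * m + 2)
    (h3 : conj l 0 = 3 * m - 7 → 2 ≤ conj l 1) : l ∈ Dset 3 (2 * m - 5) (allowedSet m) := by
  have hs := hl.1.conj_support
  have htot := sum_conj_eq_psize hl.1
  rw [hl.2] at htot
  obtain ⟨C, hC⟩ : ∃ C, l 0 = C + 2 := by
    refine ⟨l 0 - 2, ?_⟩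
    by_contra hlt
    have hl2 : l 0 ≤ 1 := by omega
    have : ∑ c ∈ Finset.range (l 0), conj l c ≤ ∑ c ∈ Finset.range 1, conj l c :=
      Finset.sum_le_sum_of_subset (Finset.range_subset_range.2 hl2)
    simp only [Finset.sum_range_one] at this
    omega
  rw [hC] at hs htot
  obtain ⟨x, y, z, hxyz, hx, hy, hz, hne⟩ := exists_tall_cut hm h1 h2
  obtain ⟨w, hw1, hw2, hw3⟩ : ∃ w, w ≤ conj l 1 ∧ (z = m - 5 → w = 2) ∧ w ≤ 2 := by
    by_cases h : z = m - 5
    · exact ⟨2, h3 (by omega), fun _ => rfl, le_rfl⟩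
    · exact ⟨0, by omega, by omega, by omega⟩
  obtain ⟨p, q, o, hsum, ⟨rfl, rfl, rfl, ho1⟩, hp, hq, ho⟩ :=
    exists_cut_first_column htot hxyz hw1 (by omega) (by omega) (by omega)
  obtain ⟨sp, sq, so⟩ := support_of_sum hsum hs
  refine mem_Dset_of_columns hl hsum (conj_mem_allowedSet_of_tall hm sp hp (by omega))
    (conj_mem_allowedSet_of_tall hm sq hq (by omega))
    (conj_mem_allowedSet_of_tall hm so ho (by omega)) ?_
  have bound : ∀ (f : ℕ → ℕ), (∀ c, C + 2 ≤ c → f c = 0) →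
      ∑ c ∈ Finset.range (C + 2), f c = 2 * m - 5 → m - 4 ≤ f 0 →
      ∀ c, f c ≤ max (f 0) (m - 1) := by
    intro f hf hfs h0 c
    rcases Nat.eq_zero_or_pos c with rfl | hc
    · omega
    · have := le_sum_sub_of_ne_zero hf (c := c) (by omega)
      clear hx hy hz hne
      omega
  by_cases hz' : p 0 = m + 2 ∨ q 0 ≤ m - 1
  · exact Or.inl (conj_ne_conj_of_height sp (c := 0) (V := max (q 0) (m - 1)) (by omega)
      (bound _ sq hq (by omega)))
  · exact Or.inr (conj_ne_conj_of_height sq (c := 0) (V := max (o 0) (m - 1)) (by omega)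
      (bound _ so ho (by omega)))

/-! ### Fair splittings into three parts -/

/-- The `i`-th of three nearly equal shares of `h c`, with nearly equal partial sums. -/
def fairShare (h : ℕ → ℕ) (i c : ℕ) : ℕ :=
  (∑ x ∈ Finset.range (c + 1), h x + i) / 3 - (∑ x ∈ Finset.range c, h x + i) / 3

theorem fairShare_add (h : ℕ → ℕ) (c : ℕ) :
    fairShare h 0 c + fairShare h 1 c + fairShare h 2 c = h c := by
  simp only [fairShare, Finset.sum_range_succ]
  omega

theorem fairShare_bounds (h : ℕ → ℕ) (i c : ℕ) :
    3 * fairShare h i c ≤ h c + 2 ∧ h c ≤ 3 * fairShare h i c + 2 := by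
  simp only [fairShare, Finset.sum_range_succ]
  omega

theorem sum_fairShare (h : ℕ → ℕ) {i : ℕ} (hi : i < 3) (n : ℕ) :
    ∑ c ∈ Finset.range n, fairShare h i c = (∑ c ∈ Finset.range n, h c + i) / 3 := by
  induction n with
  | zero => simp; omega
  | succ n ih =>
    rw [Finset.sum_range_succ, ih]
    simp only [fairShare, Finset.sum_range_succ]
    omega

theorem sum_residue (g : ℕ → ℕ) (K : ℕ) {i : ℕ} (hi : i < 3) :
    (∑ c ∈ Finset.range (3 * K), if c % 3 = i then g c else 0) =
      ∑ k ∈ Finset.range K, g (3 * k + i) := by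
  induction K with
  | zero => simp
  | succ K ih =>
    rw [show 3 * (K + 1) = 3 * K + 1 + 1 + 1 by ring, Finset.sum_range_succ, Finset.sum_range_succ,
      Finset.sum_range_succ, ih, Finset.sum_range_succ]
    obtain rfl | rfl | rfl : i = 0 ∨ i = 1 ∨ i = 2 := by omega
    · rw [if_pos (by omega), if_neg (by omega), if_neg (by omega)]
      rfl
    · rw [if_neg (by omega), if_pos (by omega), if_neg (by omega)]
      rfl
    · rw [if_neg (by omega), if_neg (by omega), if_pos (by omega)]
      rfl

theorem residue_sums_close {g : ℕ → ℕ} (hg : Antitone g) (K : ℕ) :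
    ∑ k ∈ Finset.range K, g (3 * k + 1) ≤ ∑ k ∈ Finset.range K, g (3 * k + 0) ∧
    ∑ k ∈ Finset.range K, g (3 * k + 2) ≤ ∑ k ∈ Finset.range K, g (3 * k + 1) ∧
    ∑ k ∈ Finset.range K, g (3 * k + 0) + g (3 * K) ≤
      ∑ k ∈ Finset.range K, g (3 * k + 2) + g 0 := by
  refine ⟨Finset.sum_le_sum fun k _ => hg (by omega), Finset.sum_le_sum fun k _ => hg (by omega),
    ?_⟩
  induction K with
  | zero => simp
  | succ K ih =>
    rw [Finset.sum_range_succ, Finset.sum_range_succ]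
    have := hg (show 3 * K + 2 ≤ 3 * (K + 1) by omega)
    rw [add_zero]
    omega

theorem thirds_add (n : ℕ) : (n + 0) / 3 + (n + 1) / 3 + (n + 2) / 3 = n := by
  omega

theorem third_add_le {T H e x : ℕ} (i : ℕ) (hH : H = T + e) (hx : 3 * x ≤ e) :
    (T + i) / 3 + x ≤ (H + i) / 3 := by
  rw [← Nat.add_mul_div_left _ _ (show 0 < 3 by omega)]
  exact Nat.div_le_div_right (by omega)

/-- Three functions of nearly equal sums and small supports adding up to a given antitone
function: the first five values are shared fairly, the next two are used to balance the sums, and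
the remaining values are dealt out in turn. -/
theorem exists_fair_split {h : ℕ → ℕ} (hh : Antitone h) (K : ℕ)
    (hs : ∀ c, 7 + 3 * K ≤ c → h c = 0) :
    ∃ F : ℕ → ℕ → ℕ, (∀ c, F 0 c + F 1 c + F 2 c = h c) ∧
      (∀ i, i < 3 → ∑ c ∈ Finset.range (7 + 3 * K), F i c =
        (∑ c ∈ Finset.range (7 + 3 * K), h c + i) / 3) ∧
      (∀ i, i < 3 → conj (F i) 0 ≤ 7 + K) ∧
      (∀ i c, i < 3 → c < 5 → 3 * F i c ≤ h c + 2) ∧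
      (∀ i c, i < 3 → F i (7 + c) = if c % 3 = i then h (7 + c) else 0) := by
  set T := ∑ c ∈ Finset.range 5, h c with hT
  set S : ℕ → ℕ := fun i => ∑ k ∈ Finset.range K, h (7 + (3 * k + i)) with hS
  obtain ⟨hS1, hS2, hS3⟩ := residue_sums_close (g := fun c => h (7 + c))
    (fun a b hab => hh (by omega)) K
  have hdealt : ∀ i, i < 3 →
      (∑ c ∈ Finset.range (3 * K), if c % 3 = i then h (7 + c) else 0) = S i := fun i hi =>
    sum_residue (fun c => h (7 + c)) K hi
  have hrest : ∑ c ∈ Finset.range (3 * K), h (7 + c) = S 0 + S 1 + S 2 := by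
    rw [← hdealt 0 (by omega), ← hdealt 1 (by omega), ← hdealt 2 (by omega),
      ← Finset.sum_add_distrib, ← Finset.sum_add_distrib]
    refine Finset.sum_congr rfl fun c _ => ?_
    split_ifs <;> omega
  have hH : ∑ c ∈ Finset.range (7 + 3 * K), h c = T + h 5 + h 6 + (S 0 + S 1 + S 2) := by
    rw [Finset.sum_range_add, hrest, Finset.sum_range_succ, Finset.sum_range_succ]
  set H := ∑ c ∈ Finset.range (7 + 3 * K), h c with hHdef
  have h65 := hh (show 5 ≤ 6 by omega)
  have h76 := hh (show 6 ≤ 7 by omega)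
  change S 1 ≤ S 0 at hS1
  change S 2 ≤ S 1 at hS2
  change S 0 + _ ≤ S 2 + h 7 at hS3
  have hle : ∀ i, i < 3 → (T + i) / 3 + S i ≤ (H + i) / 3 := by
    intro i hi
    refine third_add_le i (e := h 5 + h 6 + (S 0 + S 1 + S 2)) (by rw [hH]; ring) ?_
    clear_value S T H
    clear hdealt hrest hH
    obtain rfl | rfl | rfl : i = 0 ∨ i = 1 ∨ i = 2 := by omega
    all_goals omega
  have hd : ∑ c ∈ Finset.range 7, (if c < 5 then 0 else h c) =
      ((H + 0) / 3 - ((T + 0) / 3 + S 0)) + ((H + 1) / 3 - ((T + 1) / 3 + S 1)) +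
        ((H + 2) / 3 - ((T + 2) / 3 + S 2)) := by
    have e0 := hle 0 (by omega)
    have e1 := hle 1 (by omega)
    have e2 := hle 2 (by omega)
    have eT := thirds_add T
    have eH := thirds_add H
    have : ∑ c ∈ Finset.range 7, (if c < 5 then 0 else h c) = h 5 + h 6 := by
      simp [Finset.sum_range_succ]
    rw [this]
    clear this
    clear_value S T H
    generalize (T + 0) / 3 = t0 at *
    generalize (T + 1) / 3 = t1 at *
    generalize (T + 2) / 3 = t2 at *
    generalize (H + 0) / 3 = u0 at *
    generalize (H + 1) / 3 = u1 at *
    generalize (H + 2) / 3 = u2 at *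
    clear hle hdealt hrest
    omega
  obtain ⟨p, q, o, hpqo, hp, hq, ho⟩ := exists_cut _ _ _ _ _ hd
  set f : ℕ → ℕ → ℕ := fun i => if i = 0 then p else if i = 1 then q else o with hf
  have hf5 : ∀ i c, i < 3 → c < 5 → f i c = 0 := by
    intro i c hi hc
    have := hpqo c
    rw [if_pos hc] at this
    simp only [hf]
    split_ifs <;> omega
  have hfs : ∀ i, i < 3 → ∑ c ∈ Finset.range 7, f i c = (H + i) / 3 - ((T + i) / 3 + S i) := by
    intro i hi
    obtain rfl | rfl | rfl : i = 0 ∨ i = 1 ∨ i = 2 := by omega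
    · simpa [hf] using hp
    · simpa [hf] using hq
    · simpa [hf] using ho
  let F : ℕ → ℕ → ℕ := fun i c => if c < 5 then fairShare h i c else if c < 7 then f i c else
    if (c - 7) % 3 = i then h c else 0
  have hF7 : ∀ i c, F i (7 + c) = if c % 3 = i then h (7 + c) else 0 := by
    intro i c
    simp only [F]
    rw [if_neg (by omega), if_neg (by omega), Nat.add_sub_cancel_left]
  refine ⟨F, fun c => ?_, fun i hi => ?_, fun i hi => ?_, fun i c _ hc => ?_, fun i c _ => hF7 i c⟩
  · simp only [F]
    by_cases h5 : c < 5
    · simp only [h5, if_true]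
      exact fairShare_add h c
    · by_cases h7 : c < 7
      · have := hpqo c
        simp only [h5, h7, if_true, if_false] at this ⊢
        simpa [hf] using this
      · simp only [h5, h7, if_false]
        split_ifs <;> omega
  · rw [Finset.sum_range_add]
    have e1 : ∑ c ∈ Finset.range 7, F i c = ∑ c ∈ Finset.range 5, fairShare h i c +
        ∑ c ∈ Finset.range 7, f i c := by
      have e5 := hf5 i
      have : ∑ c ∈ Finset.range 7, f i c = f i 5 + f i 6 := by
        simp only [Finset.sum_range_succ, Finset.sum_range_zero, e5 _ hi (show 0 < 5 by omega),
          e5 _ hi (show 1 < 5 by omega), e5 _ hi (show 2 < 5 by omega),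
          e5 _ hi (show 3 < 5 by omega), e5 _ hi (show 4 < 5 by omega), zero_add]
      rw [this, Finset.sum_range_succ, Finset.sum_range_succ, add_assoc]
      congr 1
    rw [e1, sum_fairShare h hi, hfs i hi, Finset.sum_congr rfl fun c _ => hF7 i c, hdealt i hi]
    have := hle i hi
    rw [← hT]
    clear_value S T H
    clear hle hdealt hfs
    generalize (T + i) / 3 = t at *
    generalize (H + i) / 3 = u at *
    omega
  · rw [conj_eq_sum (C := 7 + 3 * K), Finset.sum_range_add]
    · have e1 : (∑ c ∈ Finset.range 7, if 0 < F i c then 1 else 0) ≤ 7 := by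
        refine (Finset.sum_le_sum (g := fun _ => 1) fun c _ => ?_).trans (by simp)
        split_ifs <;> omega
      have e2 : (∑ c ∈ Finset.range (3 * K), if 0 < F i (7 + c) then 1 else 0) ≤ K := by
        have := sum_residue (fun _ => 1) K hi
        simp only [Finset.sum_const, Finset.card_range, smul_eq_mul, mul_one] at this
        refine le_trans (Finset.sum_le_sum fun c _ => ?_) this.le
        rw [hF7]
        split_ifs <;> omega
      omega
    · intro c hc
      obtain ⟨c, rfl⟩ : ∃ d, c = 7 + d := ⟨c - 7, by omega⟩
      rw [hF7, hs _ hc]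
      simp
  · simp only [F, hc, if_true]
    exact (fairShare_bounds h i c).1

/-! ### Moving a single cell -/

/-- Move one unit of `f` from position `a` to position `b`. -/
def moveCell (f : ℕ → ℕ) (a b : ℕ) : ℕ → ℕ :=
  fun x => f x - (if x = a then 1 else 0) + (if x = b then 1 else 0)

theorem moveCell_add {p q : ℕ → ℕ} {a b : ℕ} (hp : 1 ≤ p a) (hq : 1 ≤ q b) (c : ℕ) :
    moveCell p a b c + moveCell q b a c = p c + q c := by
  simp only [moveCell]
  split_ifs with h1 h2 h2
  · subst h1; subst h2; omega
  · subst h1; omega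
  · subst h2; omega
  · omega

theorem sum_le_count_mul {f : ℕ → ℕ} {C V : ℕ} (hf : ∀ c, C ≤ c → f c = 0) (hV : ∀ c, f c ≤ V) :
    ∑ c ∈ Finset.range C, f c ≤ conj f 0 * V := by
  rw [conj_eq_sum hf, Finset.sum_mul]
  refine Finset.sum_le_sum fun c _ => ?_
  have := hV c
  split_ifs <;> omega

theorem sum_moveCell {f : ℕ → ℕ} {a b C : ℕ} (ha : a < C) (hb : b < C) (h : 1 ≤ f a) :
    ∑ c ∈ Finset.range C, moveCell f a b c = ∑ c ∈ Finset.range C, f c := by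
  have h1 : ∑ c ∈ Finset.range C, (f c - (if c = a then 1 else 0)) +
      ∑ c ∈ Finset.range C, (if c = a then 1 else 0) = ∑ c ∈ Finset.range C, f c := by
    rw [← Finset.sum_add_distrib]
    refine Finset.sum_congr rfl fun c _ => ?_
    split_ifs with h
    · subst h; omega
    · omega
  simp only [moveCell]
  rw [Finset.sum_add_distrib, ← h1]
  simp [ha, hb]

theorem conj_moveCell_le {f : ℕ → ℕ} {C : ℕ} (hf : ∀ c, C ≤ c → f c = 0) (a b : ℕ) :
    conj (moveCell f a b) 0 ≤ conj f 0 + 1 := by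
  have : {x | 0 < f x}.Finite := (Set.finite_Iio C).subset fun x hx => by
    by_contra hc
    have h1 : 0 < f x := hx
    rw [hf x (not_lt.1 hc)] at h1
    omega
  refine (Set.ncard_le_ncard (t := insert b {x | 0 < f x}) (fun x hx => ?_)
    (this.insert b)).trans (Set.ncard_insert_le _ _)
  by_cases hxb : x = b
  · exact Or.inl hxb
  · right
    have h1 : 0 < moveCell f a b x := hx
    simp only [moveCell, hxb, if_false] at h1
    change 0 < f x
    omega

theorem conj_moveCell_eq {f : ℕ → ℕ} {C : ℕ} (hf : ∀ c, C ≤ c → f c = 0) {a b : ℕ}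
    (ha : 2 ≤ f a) (hb : f b = 0) : conj (moveCell f a b) 0 = conj f 0 + 1 := by
  have : {x | 0 < f x}.Finite := (Set.finite_Iio C).subset fun x hx => by
    by_contra hc
    have h1 : 0 < f x := hx
    rw [hf x (not_lt.1 hc)] at h1
    omega
  rw [conj, conj, ← Set.ncard_insert_of_notMem (a := b) (by simp [hb]) this]
  congr 1
  ext x
  simp only [moveCell, Set.mem_ofPred_eq, Set.mem_insert_iff]
  split_ifs with h1 h2 h2
  · subst h1; simp [h2]
  · subst h1; simp [h2]; omega
  · simp [h2]
  · simp [h2]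

/-! ### One long row -/

theorem IsPartition.antitone_conj {f : ℕ → ℕ} (hf : IsPartition f) : Antitone (conj f) := by
  obtain ⟨-, N, hN⟩ := hf
  exact (isPartition_conj hN).1

theorem mul_le_sum_of_antitone {h : ℕ → ℕ} {C : ℕ} (hh : Antitone h)
    (hs : ∀ c, C ≤ c → h c = 0) (c : ℕ) : (c + 1) * h c ≤ ∑ x ∈ Finset.range C, h x := by
  rcases le_or_gt C c with hc | hc
  · simp [hs c hc]
  · calc (c + 1) * h c = ∑ _x ∈ Finset.range (c + 1), h c := by simp
      _ ≤ ∑ x ∈ Finset.range (c + 1), h x :=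
        Finset.sum_le_sum fun x hx => hh (Nat.lt_succ_iff.1 (Finset.mem_range.1 hx))
      _ ≤ ∑ x ∈ Finset.range C, h x := Finset.sum_le_sum_of_subset
        (Finset.range_subset_range.2 hc)

theorem exists_pos_of_sum_pos {f : ℕ → ℕ} {C : ℕ} (h : 0 < ∑ c ∈ Finset.range C, f c) :
    ∃ c, c < C ∧ 1 ≤ f c := by
  by_contra! hc
  have : ∑ c ∈ Finset.range C, f c = 0 := Finset.sum_eq_zero fun c hx => by
    have := hc c (Finset.mem_range.1 hx)
    omega
  omega

theorem sum_remove_cell {f : ℕ → ℕ} {a C : ℕ} (ha : a < C) (h : 1 ≤ f a) :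
    ∑ c ∈ Finset.range C, (f c - if c = a then 1 else 0) + 1 = ∑ c ∈ Finset.range C, f c := by
  have : ∑ c ∈ Finset.range C, (if c = a then 1 else 0) = 1 := by simp [ha]
  rw [← this, ← Finset.sum_add_distrib]
  refine Finset.sum_congr rfl fun c _ => ?_
  split_ifs with hc
  · subst hc; omega
  · omega

theorem sum_add_cell (f : ℕ → ℕ) {a C : ℕ} (ha : a < C) :
    ∑ c ∈ Finset.range C, (f c + if c = a then 1 else 0) = ∑ c ∈ Finset.range C, f c + 1 := by
  rw [Finset.sum_add_distrib]
  simp [ha]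

theorem conj_add_cell_le {f : ℕ → ℕ} {C : ℕ} (hf : ∀ c, C ≤ c → f c = 0) {a : ℕ} (ha : a < C) :
    conj (fun c => f c + if c = a then 1 else 0) 0 ≤ conj f 0 + 1 := by
  have hg : ∀ c, C ≤ c → (if c = a then 1 else 0) = 0 := fun c hc => if_neg (by omega)
  refine (conj_zero_add_le hf hg).trans (Nat.add_le_add_left ?_ _)
  refine (conj_zero_le_sum hg).trans ?_
  simp [ha]

theorem mem_Dset_of_one_long_row {m : ℕ} {l : ℕ → ℕ} (hm : 43 ≤ m)
    (hl : l ∈ Pset (3 * (2 * m - 5))) (h1 : l 0 ≤ 3 * m - 3) (h2 : 3 * m - 25 ≤ l 0)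
    (h3 : l 1 ≤ 2 * m - 1) (h4 : conj l 0 ≤ 3 * m - 7) :
    l ∈ Dset 3 (2 * m - 5) (allowedSet m) := by
  have hρ := hl.1.tailPart
  have hsz := psize_tailPart hl.1
  rw [hl.2] at hsz
  obtain ⟨K, hK⟩ : ∃ K, l 1 ≤ 7 + 3 * K ∧ 7 + K + 1 ≤ m - 9 := ⟨(l 1 - 5) / 3, by omega⟩
  have hs : ∀ c, 7 + 3 * K ≤ c → conj (tailPart l) c = 0 := fun c hc =>
    hρ.conj_support c (hK.1.trans hc)
  have hh : Antitone (conj (tailPart l)) := hρ.antitone_conj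
  have hsum := sum_range_conj_eq_psize hρ hK.1
  obtain ⟨F, hF, hFs, hFc, hF5, hF7⟩ := exists_fair_split hh K hs
  have h5 := mul_le_sum_of_antitone hh hs 5
  rw [hsum] at h5 hFs
  have h0 := conj_tailPart hl.1 0
  have hle : ∀ i c, i < 3 → F i c ≤ m - 2 := by
    intro i c hi
    rcases lt_or_ge c 5 with hc | hc
    · have := hF5 i c hi hc
      have := hh (Nat.zero_le c)
      omega
    · have := hF c
      have := hh hc
      obtain rfl | rfl | rfl : i = 0 ∨ i = 1 ∨ i = 2 := by omega
      all_goals omega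
  obtain ⟨sp, sq, so⟩ := support_of_sum hF hs
  have key : ∀ (f : ℕ → ℕ) (k : ℕ), (∀ c, 7 + 3 * K ≤ c → f c = 0) → k ≤ m → m - 9 ≤ k →
      k + ∑ c ∈ Finset.range (7 + 3 * K), f c = 2 * m - 5 → conj f 0 ≤ 7 + K + 1 →
      (∀ c, f c ≤ m - 1) → consPart k (conj f) ∈ allowedSet m :=
    fun f k hf hk hk' hs hc hle => consPart_mem_allowedSet hm hf hs hk' (Or.inl hk) (by omega)
      (fun c => (hle c).trans (by omega)) (by omega) fun _ => hle
  have e0 := hFs 0 (by omega)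
  have e1 := hFs 1 (by omega)
  have e2 := hFs 2 (by omega)
  have n0 := hFc 0 (by omega)
  have n1 := hFc 1 (by omega)
  have n2 := hFc 2 (by omega)
  clear hF5 hF7 hFc hFs h5 h4
  obtain ⟨D, hD⟩ : ∃ D, D = psize (tailPart l) / 3 := ⟨_, rfl⟩
  by_cases h30 : psize (tailPart l) % 3 = 0
  · obtain ⟨c, hc, hpc⟩ := exists_pos_of_sum_pos (f := F 0) (C := 7 + 3 * K) (by omega)
    refine mem_Dset_of_row_columns (a := 2 * m - 5 - (D - 1)) (b := 2 * m - 5 - D)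
      (d := 2 * m - 5 - (D + 1)) hl (by omega)
      (p := fun x => F 0 x - if x = c then 1 else 0) (q := F 1)
      (o := fun x => F 2 x + if x = c then 1 else 0) (fun x => ?_)
      (key _ _ (fun x hx => ?_) ?_ ?_ ?_ ?_ fun x => ?_)
      (key _ _ sq (by omega) (by omega) (by omega) (by omega)
        fun x => (hle 1 x (by omega)).trans (by omega))
      (key _ _ (fun x hx => ?_) (by omega) (by omega) ?_ ?_ fun x => ?_) (Or.inl (by omega))
    · rw [← hF x]
      split_ifs with hx
      · subst hx; omega
      · omega
    · simp [sp x hx]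
    · omega
    · omega
    · have := sum_remove_cell hc hpc
      omega
    · have : conj (fun x => F 0 x - if x = c then 1 else 0) 0 ≤ conj (F 0) 0 :=
        conj_le_conj sp fun x hx => by omega
      omega
    · have := hle 0 x (by omega)
      omega
    · rw [so x hx, if_neg (by omega)]
    · rw [sum_add_cell _ hc]
      omega
    · have := conj_add_cell_le so hc
      omega
    · have := hle 2 x (by omega)
      split_ifs <;> omega
  · refine mem_Dset_of_row_columns
      (a := 2 * m - 5 - psize (tailPart l) / 3) (b := 2 * m - 5 - (psize (tailPart l) + 1) / 3)
      (d := 2 * m - 5 - (psize (tailPart l) + 2) / 3) hl ?_ hF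
      (key _ _ sp ?_ ?_ ?_ (by omega) fun x => (hle 0 x (by omega)).trans (by omega))
      (key _ _ sq ?_ ?_ ?_ (by omega) fun x => (hle 1 x (by omega)).trans (by omega))
      (key _ _ so ?_ ?_ ?_ (by omega) fun x => (hle 2 x (by omega)).trans (by omega)) ?_
    all_goals
      clear hle key sp sq so hF hh hs
      omega

/-! ### Short first row and column -/

theorem conj_le_of_support {f : ℕ → ℕ} {C : ℕ} (hf : ∀ c, C ≤ c → f c = 0) (j : ℕ) :
    conj f j ≤ C := by
  rw [conj_eq_sum hf]
  refine (Finset.sum_le_sum (g := fun _ => 1) fun c _ => ?_).trans (by simp)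
  split_ifs <;> omega

theorem moveCell_support {f : ℕ → ℕ} {a b C : ℕ} (hf : ∀ c, C ≤ c → f c = 0) (hb : b < C) :
    ∀ c, C ≤ c → moveCell f a b c = 0 := by
  intro c hc
  simp only [moveCell, hf c hc]
  rw [if_neg (show c ≠ b by omega)]
  simp

theorem moveCell_le (f : ℕ → ℕ) (a b c : ℕ) : moveCell f a b c ≤ f c + 1 := by
  simp only [moveCell]
  split_ifs <;> omega

/-- Criterion for membership in `allowedSet m` of a partition with short rows and columns. -/
theorem conj_mem_allowedSet_of_short {m C : ℕ} {f : ℕ → ℕ} (hm : 43 ≤ m)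
    (hf : ∀ c, C ≤ c → f c = 0) (hs : ∑ c ∈ Finset.range C, f c = 2 * m - 5)
    (hcount : conj f 0 ≤ m - 3) (hle : ∀ c, f c ≤ m - 2)
    (hcol : (∃ c, 1 ≤ f c ∧ f c ≤ m - 4) ∨ conj f 0 ≠ 2) : conj f ∈ allowedSet m :=
  conj_mem_allowedSet hm hf hs (by omega) (Or.inl hcount) (fun c => (hle c).trans (by omega))
    (Or.inl fun c => (hle c).trans (by omega)) (hcol.imp_right Or.inr)

theorem mem_Dset_of_short {m : ℕ} {l : ℕ → ℕ} (hm : 43 ≤ m)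
    (hl : l ∈ Pset (3 * (2 * m - 5))) (h1 : 12 ≤ l 0) (h2 : l 0 ≤ 3 * m - 26)
    (h3 : conj l 0 ≤ 3 * m - 9) : l ∈ Dset 3 (2 * m - 5) (allowedSet m) := by
  obtain ⟨K, hK, hK'⟩ : ∃ K, l 0 ≤ 7 + 3 * K ∧ 7 + K ≤ m - 4 := ⟨(l 0 - 5) / 3, by omega⟩
  have hh := hl.1.antitone_conj
  have hs : ∀ c, 7 + 3 * K ≤ c → conj l c = 0 := fun c hc =>
    hl.1.conj_support c (hK.trans hc)
  have hpos : ∀ c, c < 12 → 1 ≤ conj l c := fun c hc =>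
    (lt_conj_iff hl.1 0 c).2 (by omega)
  have hsum := sum_range_conj_eq_psize hl.1 hK
  obtain ⟨F, hF, hFs, hFc, hF5, hF7⟩ := exists_fair_split hh K hs
  have h5 := mul_le_sum_of_antitone hh hs 5
  have h7 := mul_le_sum_of_antitone hh hs 7
  rw [hsum, hl.2] at h5 h7 hFs
  have hle : ∀ i c, i < 3 → F i c ≤ m - 3 := by
    intro i c hi
    rcases lt_or_ge c 5 with hc | hc
    · have := hF5 i c hi hc
      have := hh (Nat.zero_le c)
      omega
    · have := hF c
      have := hh hc
      obtain rfl | rfl | rfl : i = 0 ∨ i = 1 ∨ i = 2 := by omega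
      all_goals omega
  have hsize : ∀ i, i < 3 → ∑ c ∈ Finset.range (7 + 3 * K), F i c = 2 * m - 5 := by
    intro i hi
    rw [hFs i hi]
    omega
  obtain ⟨sp, sq, so⟩ := support_of_sum hF hs
  have hdealt : ∀ i c, i < 3 → c < 5 → c % 3 = i → 1 ≤ F i (7 + c) ∧ F i (7 + c) ≤ m - 4 := by
    intro i c hi hc hci
    rw [hF7 i c hi, if_pos hci]
    have := hh (show 7 ≤ 7 + c by omega)
    exact ⟨hpos _ (by omega), by omega⟩
  have hout : ∀ i c, i < 3 → c % 3 ≠ i → F i (7 + c) = 0 := fun i c hi hc => by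
    rw [hF7 i c hi, if_neg hc]
  clear hF5 hF7 hFs h5 h7
  have mem : ∀ i, i < 3 → (∀ c, 7 + 3 * K ≤ c → F i c = 0) → conj (F i) ∈ allowedSet m := by
    intro i hi hf
    exact conj_mem_allowedSet_of_short hm hf (hsize i hi) ((hFc i hi).trans (by omega))
      (fun c => (hle i c hi).trans (by omega))
      (Or.inl ⟨7 + i, hdealt i i hi (by omega) (by omega)⟩)
  by_cases hne : conj (F 0) ≠ conj (F 1) ∨ conj (F 1) ≠ conj (F 2)
  · exact mem_Dset_of_columns hl hF (mem 0 (by omega) sp) (mem 1 (by omega) sq)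
      (mem 2 (by omega) so) hne
  · push Not at hne
    have n0 := hFc 0 (by omega)
    have n1 := hFc 1 (by omega)
    have s0 := hsize 0 (by omega)
    obtain ⟨c, hc⟩ : ∃ c, 2 ≤ F 0 c := by
      by_contra! hc
      have := sum_le_count_mul (V := 1) sp fun c => by have := hc c; omega
      omega
    have hcC : c < 7 + 3 * K := by
      by_contra hcC
      rw [sp c (by omega)] at hc
      omega
    have p8 : F 0 8 = 0 := hout 0 1 (by omega) (by omega)
    have p11 : F 0 11 = 0 := hout 0 4 (by omega) (by omega)
    have q8 : 1 ≤ F 1 8 ∧ _ := hdealt 1 1 (by omega) (by omega) (by omega)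
    have q11 : 1 ≤ F 1 11 ∧ F 1 11 ≤ m - 4 := hdealt 1 4 (by omega) (by omega) (by omega)
    have hc8 : c ≠ 8 := by rintro rfl; omega
    have hc11 : 11 ≠ c := by rintro rfl; omega
    have h8C : 8 < 7 + 3 * K := by omega
    have hcount := conj_moveCell_eq sp hc p8
    refine mem_Dset_of_columns hl (p := moveCell (F 0) c 8) (q := moveCell (F 1) 8 c) (o := F 2)
      (fun x => ?_)
      (conj_mem_allowedSet_of_short hm (moveCell_support sp h8C) ?_ ?_ (fun x => ?_)
        (Or.inl ⟨8, ?_⟩))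
      (conj_mem_allowedSet_of_short hm (moveCell_support sq hcC) ?_ ?_ (fun x => ?_)
        (Or.inl ⟨11, ?_⟩))
      (mem 2 (by omega) so) ?_
    · rw [moveCell_add (by omega) q8.1, hF x]
    · rw [sum_moveCell hcC h8C (by omega), s0]
    · omega
    · have := moveCell_le (F 0) c 8 x
      have := hle 0 x (by omega)
      omega
    · simp only [moveCell, p8, if_neg hc8.symm, if_true]
      omega
    · rw [sum_moveCell h8C hcC q8.1, hsize 1 (by omega)]
    · have := conj_moveCell_le sq 8 c
      omega
    · have := moveCell_le (F 1) 8 c x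
      have := hle 1 x (by omega)
      omega
    · simpa only [moveCell, if_neg hc11, if_neg (show (11 : ℕ) ≠ 8 by omega), Nat.sub_zero,
        Nat.add_zero] using q11
    · by_contra! hcon
      have := congrFun (hcon.1.trans hcon.2) 0
      rw [← hne.2, ← hne.1] at this
      omega

theorem mem_Dset_of_narrow {m : ℕ} {l : ℕ → ℕ} (hm : 43 ≤ m)
    (hl : l ∈ Pset (3 * (2 * m - 5))) (h2 : l 0 ≤ 11)
    (h3 : conj l 0 ≤ 3 * m - 9) : l ∈ Dset 3 (2 * m - 5) (allowedSet m) := by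
  have hh := hl.1.antitone_conj
  have hs : ∀ c, 11 ≤ c → conj l c = 0 := fun c hc => hl.1.conj_support c (h2.trans hc)
  have hsum := sum_range_conj_eq_psize hl.1 h2
  rw [hl.2] at hsum
  obtain ⟨F, hFdef⟩ : ∃ F, F = fairShare (conj l) := ⟨_, rfl⟩
  have hF : ∀ c, F 0 c + F 1 c + F 2 c = conj l c := hFdef ▸ fairShare_add (conj l)
  have hb : ∀ i c, 3 * F i c ≤ conj l c + 2 ∧ conj l c ≤ 3 * F i c + 2 :=
    hFdef ▸ fairShare_bounds (conj l)
  have hsize : ∀ i, i < 3 → ∑ c ∈ Finset.range 11, F i c = 2 * m - 5 := by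
    intro i hi
    rw [hFdef, sum_fairShare _ hi, hsum]
    omega
  have hle : ∀ i c, F i c ≤ m - 3 := by
    intro i c
    have := (hb i c).1
    have := hh (Nat.zero_le c)
    omega
  obtain ⟨sp, sq, so⟩ := support_of_sum hF hs
  have mem : ∀ i, i < 3 → (∀ c, 11 ≤ c → F i c = 0) → conj (F i) ∈ allowedSet m := by
    intro i hi hf
    refine conj_mem_allowedSet_of_short hm hf (hsize i hi)
      ((conj_le_of_support hf 0).trans (by omega)) (fun c => (hle i c).trans (by omega))
      (Or.inr fun h => ?_)
    have := sum_le_count_mul hf (hle i)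
    rw [h, hsize i hi] at this
    omega
  by_cases hne : conj (F 0) ≠ conj (F 1) ∨ conj (F 1) ≠ conj (F 2)
  · exact mem_Dset_of_columns hl hF (mem 0 (by omega) sp) (mem 1 (by omega) sq)
      (mem 2 (by omega) so) hne
  · push Not at hne
    obtain ⟨c, hc, hmax⟩ := Finset.exists_max_image (Finset.range 11) (F 0) ⟨0, by simp⟩
    rw [Finset.mem_range] at hc
    have hmax' : ∀ x, F 0 x ≤ F 0 c := fun x => by
      rcases lt_or_ge x 11 with hx | hx
      · exact hmax x (Finset.mem_range.2 hx)
      · rw [sp x hx]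
        exact Nat.zero_le _
    have hpc : 8 ≤ F 0 c := by
      have h4 := sum_le_count_mul sp hmax'
      rw [hsize 0 (by omega)] at h4
      have := h4.trans (Nat.mul_le_mul_right _ (conj_le_of_support sp 0))
      omega
    have hcol : 12 ≤ conj l 1 := by
      have h4 : ∑ x ∈ Finset.range 10, conj l (x + 1) ≤ ∑ _x ∈ Finset.range 10, conj l 1 :=
        Finset.sum_le_sum fun x _ => hh (by omega)
      rw [Finset.sum_range_succ'] at hsum
      simp only [Finset.sum_const, Finset.card_range, smul_eq_mul] at h4
      omega
    obtain ⟨d, hd, hdc⟩ : ∃ d, d ≤ 1 ∧ d ≠ c := by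
      by_cases h : c = 0
      · exact ⟨1, by omega⟩
      · exact ⟨0, by omega⟩
    have hd1 := hh hd
    have hpd := hb 0 d
    have hpd' := hle 0 d
    have hqc := hb 1 c
    have hpc' := hb 0 c
    have hqc' := hle 1 c
    refine mem_Dset_of_columns hl (p := moveCell (F 0) d c) (q := moveCell (F 1) c d) (o := F 2)
      (fun x => ?_)
      (conj_mem_allowedSet_of_short hm (moveCell_support sp hc) ?_
        ((conj_le_of_support (moveCell_support sp hc) 0).trans (by omega))
        (fun x => (moveCell_le _ _ _ x).trans ?_) (Or.inl ⟨d, ?_⟩))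
      (conj_mem_allowedSet_of_short hm (moveCell_support sq (show d < 11 by omega)) ?_
        ((conj_le_of_support (moveCell_support sq (show d < 11 by omega)) 0).trans (by omega))
        (fun x => (moveCell_le _ _ _ x).trans ?_) (Or.inl ⟨c, ?_⟩))
      (mem 2 (by omega) so) ?_
    · rw [moveCell_add (by omega) (by omega), hF x]
    · rw [sum_moveCell (by omega) hc (by omega), hsize 0 (by omega)]
    · have := hle 0 x
      omega
    · simp only [moveCell, if_neg hdc, if_true]
      omega
    · rw [sum_moveCell hc (by omega) (by omega), hsize 1 (by omega)]
    · have := hle 1 x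
      omega
    · simp only [moveCell, if_neg hdc.symm, if_true]
      omega
    · by_contra! hcon
      refine conj_ne_conj_of_height (c := c) (moveCell_support sp hc) ?_ hmax'
        ((hcon.1.trans hcon.2).trans (hne.1.trans hne.2).symm)
      simp only [moveCell, if_neg hdc.symm, if_true]
      omega

/-! ### The main result -/

theorem mem_Dset_allowedSet {m : ℕ} {l : ℕ → ℕ} (hm : 43 ≤ m)
    (hl : l ∈ Pset (3 * (2 * m - 5))) (h1 : l 0 ≤ 3 * m + 2) (h2 : conj l 0 ≤ 3 * m + 2) :
    l ∈ Dset 3 (2 * m - 5) (allowedSet m) := by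
  by_cases hrow : 3 * m - 2 ≤ l 0
  · exact mem_Dset_of_long_row hm hl h1 hrow
  by_cases hcol : 3 * m - 8 ≤ conj l 0
  · by_cases hhook : conj l 0 = 3 * m - 7 → 2 ≤ conj l 1
    · exact mem_Dset_of_tall hm hl hcol h2 hhook
    · push Not at hhook
      have hl1 : ¬ 1 < l 1 := fun h => by
        have := (lt_conj_iff hl.1 1 1).2 h
        omega
      have hl0 : 3 * m - 25 ≤ l 0 := by
        by_contra hl0
        have hsum := sum_range_conj_eq_psize (C := 3 * m - 25 + 1) hl.1 (by omega)
        have h4 : ∑ x ∈ Finset.range (3 * m - 25), conj l (x + 1) ≤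
            ∑ _x ∈ Finset.range (3 * m - 25), 1 := Finset.sum_le_sum fun x _ =>
          (hl.1.antitone_conj (show 1 ≤ x + 1 by omega)).trans (by omega)
        rw [Finset.sum_range_succ', hl.2] at hsum
        simp only [Finset.sum_const, Finset.card_range, smul_eq_mul] at h4
        omega
      exact mem_Dset_of_one_long_row hm hl (by omega) hl0 (by omega) (by omega)
  · by_cases hlong : 3 * m - 25 ≤ l 0
    · by_cases h1' : 2 * m ≤ l 1
      · exact mem_Dset_of_two_long_rows hm hl (by omega) hlong h1'
      · exact mem_Dset_of_one_long_row hm hl (by omega) hlong (by omega) (by omega)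
    · by_cases h12 : 12 ≤ l 0
      · exact mem_Dset_of_short hm hl h12 (by omega) (by omega)
      · exact mem_Dset_of_narrow hm hl (by omega) (by omega)

theorem Dset_mono {q n : ℕ} {A B : Set (ℕ → ℕ)} (h : A ⊆ B) : Dset q n A ⊆ Dset q n B :=
  fun _ ⟨hl, μ, hμ, hne, hpos⟩ => ⟨hl, μ, fun i => h (hμ i), hne, hpos⟩

theorem bounds_of_mem_conjClosure_pair {a b : ℕ} (ha : 2 ≤ a) (hab : b ≤ a) {f : ℕ → ℕ}
    (hf : f ∈ conjClosure {ofList [a, b]}) : IsPartition f ∧ f 0 ≤ a ∧ conj f 0 ≤ a := by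
  have hτ := isPartition_ofList_pair hab
  have h0 : ofList [a, b] 0 = a := rfl
  have h0' : conj (ofList [a, b]) 0 ≤ a := by
    rw [conj_ofList_pair]
    split_ifs <;> omega
  obtain h | ⟨g, h, rfl⟩ := hf
  · obtain rfl := Set.mem_singleton_iff.1 h
    exact ⟨hτ, h0.le, h0'⟩
  · obtain rfl := Set.mem_singleton_iff.1 h
    exact ⟨isPartition_conj (ofList_pair_support a b), h0', by rw [conj_conj hτ, h0]⟩

theorem Dset_allowedSet_union {m : ℕ} (hm : 43 ≤ m) :
    Dset 3 (2 * m - 5) (allowedSet m) =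
      Dset 3 (2 * m - 5) (allowedSet m ∪ conjClosure {ofList [m - 2, m - 3]}) := by
  refine (Dset_mono Set.subset_union_left).antisymm ?_
  rintro l ⟨hl, μ, hμ, hne, hpos⟩
  by_cases hall : ∀ i, μ i ∈ allowedSet m
  · exact ⟨hl, μ, hall, hne, hpos⟩
  push Not at hall
  obtain ⟨i, hi⟩ := hall
  have hτ : ∀ f ∈ conjClosure {ofList [m - 2, m - 3]},
      IsPartition f ∧ f 0 ≤ m - 2 ∧ conj f 0 ≤ m - 2 := fun f hf =>
    bounds_of_mem_conjClosure_pair (by omega) (by omega) hf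
  have hb : ∀ j, IsPartition (μ j) ∧ μ j 0 ≤ m + 2 ∧ conj (μ j) 0 ≤ m + 2 := by
    intro j
    obtain h | h := hμ j
    · exact ⟨h.1.1.1, h.1.2⟩
    · obtain ⟨h1, h2, h3⟩ := hτ _ h
      exact ⟨h1, by omega, by omega⟩
  obtain ⟨-, hi1, hi2⟩ := hτ _ ((hμ i).resolve_left hi)
  obtain ⟨p0, r0, c0⟩ := hb 0
  obtain ⟨p1, r1, c1⟩ := hb 1
  obtain ⟨p2, r2, c2⟩ := hb 2
  have hofFn : List.ofFn μ = [μ 0, μ 1, μ 2] := by simp [List.ofFn_succ]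
  rw [hofFn] at hpos
  obtain ⟨h1, h2⟩ := bounds_of_iterLR_three hl.1 p0 p1 p2 hpos
  refine mem_Dset_allowedSet hm hl ?_ ?_ <;> fin_cases i <;> simp at hi1 hi2 <;> omega

/-- for `k ≥ 3` and `r = (3^k + 1)/2`, with
`R = B_{3^{k+1}}(3r+3) ∖ {(3r+2, 3r−5), (3r+2, 1^{3r−5}), (3r−1, 3r−2)}°`,
one has `D(3, 3^{k+1}, R) = D(3, 3^{k+1}, R ∪ {(3r−1, 3r−2)}°)`. -/
theorem Dset_eq_of_remove_tworow (k r : ℕ) (hk : 3 ≤ k) (hr : 2 * r = 3 ^ k + 1) :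
    Dset 3 (3 ^ (k + 1))
        (Bset (3 ^ (k + 1)) (3 * r + 3) \
          conjClosure
            {ofList [3 * r + 2, 3 * r - 5], hookP (3 * r + 2) (3 * r - 5),
              ofList [3 * r - 1, 3 * r - 2]}) =
      Dset 3 (3 ^ (k + 1))
        ((Bset (3 ^ (k + 1)) (3 * r + 3) \
            conjClosure
              {ofList [3 * r + 2, 3 * r - 5], hookP (3 * r + 2) (3 * r - 5),
                ofList [3 * r - 1, 3 * r - 2]}) ∪
          conjClosure {ofList [3 * r - 1, 3 * r - 2]}) := by
  have h27 : 3 ^ 3 ≤ 3 ^ k := Nat.pow_le_pow_right (by omega) hk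
  have key := Dset_allowedSet_union (m := 3 * r + 1) (by omega)
  rw [allowedSet, show 3 * r + 1 + 2 = 3 * r + 3 by omega, show 3 * r + 1 + 1 = 3 * r + 2 by omega,
    show 3 * r + 1 - 6 = 3 * r - 5 by omega, show 3 * r + 1 - 2 = 3 * r - 1 by omega,
    show 3 * r + 1 - 3 = 3 * r - 2 by omega,
    show 2 * (3 * r + 1) - 5 = 3 ^ (k + 1) by rw [pow_succ]; omega] at key
  exact key

end SylowBranching
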